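/- Let n ≥ 0 be an integer and let 𝒫 be a class of stably finite unital C*-algebras each of which has n-comparison (in the sense of Winter). Then every simple unital C*-algebra A that is asymptotically tracially in 𝒫 has n-comparison. -/

import Mathlib

open Filter Topology Matrix

/-- Cuntz subequivalence for matrices over a topological *-ring. -/
def MatCuntzLE {R : Type} [NonUnitalRing R] [StarRing R] [TopologicalSpace R]
    {ι κ : Type} [Fintype ι] [Fintype κ] (a : Matrix ι ι R) (b : Matrix κ κ R) : Prop :=
  ∃ v : ℕ → Matrix ι κ R,
    Filter.Tendsto (fun k => v k * b * (v k)ᴴ) Filter.atTop (nhds a)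

/-- Positivity of a matrix over a C*-algebra: `a = cᴴ * c` for some `c`. -/
def MatPos {R : Type} [NonUnitalRing R] [StarRing R] {ι : Type} [Fintype ι]
    (a : Matrix ι ι R) : Prop :=
  ∃ c : Matrix ι ι R, a = cᴴ * c

/-- The `k`-fold direct sum `a ⊕ ⋯ ⊕ a`, representing `k⟨a⟩` in the Cuntz semigroup. -/
def matRep {R : Type} [NonUnitalRing R] {ι : Type} (k : ℕ) (a : Matrix ι ι R) :
    Matrix (ι × Fin k) (ι × Fin k) R :=
  Matrix.blockDiagonal fun _ : Fin k => a

/-- `β`-comparison in the sense of Kirchberg–Rørdam. -/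
def BetaComparison (R : Type) [NonUnitalRing R] [StarRing R] [TopologicalSpace R] (β : ℝ) : Prop :=
  ∀ (n m k l : ℕ), 1 ≤ k → 1 ≤ l → β * (l : ℝ) < (k : ℝ) →
    ∀ (a : Matrix (Fin n) (Fin n) R) (b : Matrix (Fin m) (Fin m) R),
      MatPos a → MatPos b → MatCuntzLE (matRep k a) (matRep l b) → MatCuntzLE a b

/-- `n`-comparison in the sense of Winter. -/
def NComparison (R : Type) [NonUnitalRing R] [StarRing R] [TopologicalSpace R] (N : ℕ) : Prop :=
  ∀ (na : ℕ) (mb : Fin (N + 1) → ℕ)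
    (a : Matrix (Fin na) (Fin na) R) (b : ∀ j, Matrix (Fin (mb j)) (Fin (mb j)) R),
    MatPos a → (∀ j, MatPos (b j)) →
    (∀ j, ∃ k : ℕ, 1 ≤ k ∧ MatCuntzLE (matRep (k + 1) a) (matRep k (b j))) →
    MatCuntzLE a (Matrix.blockDiagonal' b)

/-- Almost unperforation of the Cuntz semigroup `W(R)`. -/
def AlmostUnperforatedW (R : Type) [NonUnitalRing R] [StarRing R] [TopologicalSpace R] : Prop :=
  ∀ (n m : ℕ) (a : Matrix (Fin n) (Fin n) R) (b : Matrix (Fin m) (Fin m) R),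
    MatPos a → MatPos b →
    ∀ k : ℕ, 1 ≤ k → MatCuntzLE (matRep (k + 1) a) (matRep k b) → MatCuntzLE a b

/-- Stable finiteness: every isometry in every matrix algebra is a unitary. -/
def StablyFinite (R : Type) [Ring R] [StarRing R] : Prop :=
  ∀ (n : ℕ) (v : Matrix (Fin n) (Fin n) R), vᴴ * v = 1 → v * vᴴ = 1



/-- Cuntz subequivalence for elements of a C*-algebra. -/
def CuntzLE {A : Type} [Mul A] [Star A] [TopologicalSpace A] (a b : A) : Prop :=
  ∃ v : ℕ → A, Filter.Tendsto (fun k => v k * b * star (v k)) Filter.atTop (nhds a)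

/-- A completely positive contractive linear map between C*-algebras. -/
def IsCPC {A B : Type} [NonUnitalCStarAlgebra A] [NonUnitalCStarAlgebra B]
    [NormedSpace ℂ A] [NormedSpace ℂ B] [StarModule ℂ A] [StarModule ℂ B]
    (φ : A →ₗ[ℂ] B) : Prop :=
  (∀ x, ‖φ x‖ ≤ ‖x‖) ∧
    ∀ (n : ℕ) (a : Matrix (Fin n) (Fin n) A), MatPos a → MatPos (a.map φ)

/-- A bundled unital C*-algebra. -/
structure BundledCStarAlgebra : Type 1 where
  carrier : Type
  [str : CStarAlgebra carrier]

attribute [instance] BundledCStarAlgebra.str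

/-- A unital C*-algebra is (topologically) simple if its only closed two-sided ideals
are trivial. -/
def IsSimpleCStarAlgebra (A : Type) [CStarAlgebra A] : Prop :=
  ∀ I : TwoSidedIdeal A, IsClosed (I : Set A) → I = ⊥ ∨ I = ⊤


/-- Definition (Fu–Lin): `A` is asymptotically tracially in the class `P`. -/
def AsympTraciallyIn (P : BundledCStarAlgebra → Prop) (A : Type) [CStarAlgebra A] : Prop :=
  ∀ (ε : ℝ), 0 < ε → ∀ (F : Finset A) (c : A), (∃ d : A, c = star d * d) → c ≠ 0 →
    ∃ B : BundledCStarAlgebra, P B ∧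
      ∃ (α : A →ₗ[ℂ] B.carrier) (βn : ℕ → (B.carrier →ₗ[ℂ] A)) (γn : ℕ → (A →ₗ[ℂ] A)),
        IsCPC α ∧ (∀ n, IsCPC (βn n)) ∧ (∀ n, IsCPC (γn n)) ∧
        -- each `γn` maps into `A ∩ βn(B)^⊥`
        (∀ (n : ℕ) (x : A) (b : B.carrier),
          γn n x * βn n b = 0 ∧ βn n b * γn n x = 0) ∧
        -- (1)
        α 1 = 1 ∧
        (∀ n : ℕ, IsIdempotentElem (βn n 1) ∧ IsSelfAdjoint (βn n 1) ∧
          IsIdempotentElem (γn n 1) ∧ IsSelfAdjoint (γn n 1) ∧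
          βn n 1 + γn n 1 = 1) ∧
        -- (2)
        (∀ x ∈ F, ∀ n : ℕ, ‖x - γn n x - βn n (α x)‖ < ε) ∧
        -- (3) `α` is an `F`-`ε` approximate embedding
        (∀ x ∈ F, ∀ y ∈ F, ‖α x * α y - α (x * y)‖ < ε) ∧
        (∀ x ∈ F, ‖x‖ - ε ≤ ‖α x‖) ∧
        -- (4)
        (∀ x y : B.carrier,
          Filter.Tendsto (fun n => ‖βn n (x * y) - βn n x * βn n y‖) Filter.atTop (nhds 0) ∧
          Filter.Tendsto (fun n => ‖βn n x‖) Filter.atTop (nhds ‖x‖)) ∧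
        -- (5)
        (∀ n : ℕ, CuntzLE (γn n 1) c)

open Filter Topology Matrix

/-! ### The Cuntz preorder and the Cuntz semigroup -/

section CuntzW

variable {A : Type} [CStarAlgebra A]
variable {ι κ μ : Type} [Fintype ι] [Fintype κ] [Fintype μ]

instance matrixFirstCountable : FirstCountableTopology (Matrix ι κ A) :=
  inferInstanceAs (FirstCountableTopology (ι → κ → A))

theorem matCuntzLE_iff_closure {a : Matrix ι ι A} {b : Matrix κ κ A} :
    MatCuntzLE a b ↔ a ∈ closure (Set.range fun v : Matrix ι κ A => v * b * vᴴ) := by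
  rw [mem_closure_iff_seq_limit]
  constructor
  · rintro ⟨v, hv⟩
    exact ⟨_, fun k => ⟨v k, rfl⟩, hv⟩
  · rintro ⟨x, hx, hl⟩
    choose v hv using hx
    refine ⟨v, ?_⟩
    have : (fun k => v k * b * (v k)ᴴ) = x := funext hv
    rw [this]; exact hl

theorem matCuntzLE_conj (v : Matrix ι κ A) (b : Matrix κ κ A) : MatCuntzLE (v * b * vᴴ) b :=
  ⟨fun _ => v, tendsto_const_nhds⟩

theorem MatCuntzLE.rfl' (a : Matrix ι ι A) : MatCuntzLE a a := by
  classical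
  simpa using matCuntzLE_conj (1 : Matrix ι ι A) a

theorem MatCuntzLE.trans' {a : Matrix ι ι A} {b : Matrix κ κ A} {c : Matrix μ μ A}
    (h1 : MatCuntzLE a b) (h2 : MatCuntzLE b c) : MatCuntzLE a c := by
  rw [matCuntzLE_iff_closure] at *
  refine closure_minimal ?_ isClosed_closure h1
  rintro _ ⟨v, rfl⟩
  have hc : Continuous fun x : Matrix κ κ A => v * x * vᴴ := by fun_prop
  refine map_mem_closure (f := fun x : Matrix κ κ A => v * x * vᴴ) hc h2 ?_
  rintro _ ⟨w, rfl⟩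
  exact ⟨v * w, by simp [Matrix.mul_assoc, Matrix.conjTranspose_mul]⟩

theorem matCuntzLE_submatrix (a : Matrix ι ι A) (e : κ ≃ ι) : MatCuntzLE (a.submatrix e e) a := by
  classical
  have h := matCuntzLE_conj ((1 : Matrix ι ι A).submatrix e id) a
  convert h using 1
  ext i j
  simp [Matrix.mul_apply, Matrix.one_apply]

theorem matCuntzLE_submatrix' (a : Matrix ι ι A) (e : κ ≃ ι) :
    MatCuntzLE a (a.submatrix e e) := by
  have h := matCuntzLE_submatrix (a.submatrix e e) e.symm
  simpa using h

theorem MatCuntzLE.fromBlocks {ι' κ' : Type} [Fintype ι'] [Fintype κ']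
    {a : Matrix ι ι A} {b : Matrix κ κ A} {a' : Matrix ι' ι' A} {b' : Matrix κ' κ' A}
    (h1 : MatCuntzLE a b) (h2 : MatCuntzLE a' b') :
    MatCuntzLE (Matrix.fromBlocks a 0 0 a') (Matrix.fromBlocks b 0 0 b') := by
  obtain ⟨v, hv⟩ := h1
  obtain ⟨w, hw⟩ := h2
  refine ⟨fun k => Matrix.fromBlocks (v k) 0 0 (w k), ?_⟩
  simp only [Matrix.fromBlocks_conjTranspose, Matrix.fromBlocks_multiply]
  simp only [Matrix.zero_mul, Matrix.mul_zero, add_zero, zero_add, Matrix.conjTranspose_zero]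
  have hc : Continuous fun p : Matrix ι ι A × Matrix ι' ι' A => Matrix.fromBlocks p.1 0 0 p.2 := by
    fun_prop
  exact (hc.tendsto (a, a')).comp (hv.prodMk_nhds hw)

/-- Square matrices of arbitrary finite size. -/
def PreW (A : Type) : Type := Σ n : ℕ, Matrix (Fin n) (Fin n) A

instance : Preorder (PreW A) where
  le x y := MatCuntzLE x.2 y.2
  le_refl x := MatCuntzLE.rfl' x.2
  le_trans _ _ _ h1 h2 := MatCuntzLE.trans' h1 h2

/-- The (pre-)Cuntz semigroup. -/
def CW (A : Type) [CStarAlgebra A] : Type := Antisymmetrization (PreW A) (· ≤ ·)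

noncomputable instance : PartialOrder (CW A) :=
  inferInstanceAs (PartialOrder (Antisymmetrization (PreW A) (· ≤ ·)))

/-- The class of a square matrix. -/
noncomputable def cls (a : Matrix ι ι A) : CW A :=
  toAntisymmetrization (· ≤ ·)
    (⟨Fintype.card ι, a.submatrix (Fintype.equivFin ι).symm (Fintype.equivFin ι).symm⟩ : PreW A)

theorem cls_le_cls {a : Matrix ι ι A} {b : Matrix κ κ A} : cls a ≤ cls b ↔ MatCuntzLE a b := by
  unfold cls
  refine (toAntisymmetrization_le_toAntisymmetrization_iff (α := PreW A)).trans ?_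
  constructor
  · intro h
    exact ((matCuntzLE_submatrix' a _).trans' h).trans' (matCuntzLE_submatrix b _)
  · intro h
    exact ((matCuntzLE_submatrix a _).trans' h).trans' (matCuntzLE_submatrix' b _)

theorem cls_submatrix (a : Matrix ι ι A) (e : κ ≃ ι) : cls (a.submatrix e e) = cls a :=
  le_antisymm (cls_le_cls.2 (matCuntzLE_submatrix a e)) (cls_le_cls.2 (matCuntzLE_submatrix' a e))

theorem CW.exists_rep (x : CW A) : ∃ (n : ℕ) (a : Matrix (Fin n) (Fin n) A), cls a = x := by
  induction x using Quotient.inductionOn with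
  | h x =>
    refine ⟨x.1, x.2, ?_⟩
    apply Quotient.sound
    exact ⟨matCuntzLE_submatrix _ _, matCuntzLE_submatrix' _ _⟩

noncomputable instance : Add (CW A) where
  add x y := cls (Matrix.fromBlocks x.exists_rep.choose_spec.choose 0 0
    y.exists_rep.choose_spec.choose)

theorem cls_fromBlocks (a : Matrix ι ι A) (b : Matrix κ κ A) :
    cls (Matrix.fromBlocks a 0 0 b) = cls a + cls b := by
  have ha := (cls a).exists_rep.choose_spec.choose_spec
  have hb := (cls b).exists_rep.choose_spec.choose_spec
  refine le_antisymm ?_ ?_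
  · exact cls_le_cls.2 (MatCuntzLE.fromBlocks (cls_le_cls.1 ha.ge) (cls_le_cls.1 hb.ge))
  · exact cls_le_cls.2 (MatCuntzLE.fromBlocks (cls_le_cls.1 ha.le) (cls_le_cls.1 hb.le))

noncomputable instance : Zero (CW A) where
  zero := cls (0 : Matrix (Fin 0) (Fin 0) A)

theorem cls_zero : cls (0 : Matrix ι ι A) = 0 := by
  refine le_antisymm ?_ ?_
  · exact cls_le_cls.2 ⟨fun _ => 0, by simp⟩
  · exact cls_le_cls.2 ⟨fun _ => 0, by simp⟩

noncomputable instance : AddCommMonoid (CW A) where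
  add_assoc x y z := by
    obtain ⟨n, a, rfl⟩ := x.exists_rep
    obtain ⟨m, b, rfl⟩ := y.exists_rep
    obtain ⟨l, c, rfl⟩ := z.exists_rep
    simp only [← cls_fromBlocks]
    rw [← cls_submatrix _ (Equiv.sumAssoc _ _ _)]
    congr 1
    ext (( i | i) | i) ((j | j) | j) <;> simp [Matrix.fromBlocks]
  zero_add x := by
    obtain ⟨n, a, rfl⟩ := x.exists_rep
    rw [← cls_zero (ι := Fin 0), ← cls_fromBlocks, ← cls_submatrix _ (Equiv.emptySum (Fin 0) (Fin n)).symm]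
    congr 1
  add_zero x := by
    obtain ⟨n, a, rfl⟩ := x.exists_rep
    rw [← cls_zero (ι := Fin 0), ← cls_fromBlocks, ← cls_submatrix _ (Equiv.sumEmpty (Fin n) (Fin 0)).symm]
    congr 1
  add_comm x y := by
    obtain ⟨n, a, rfl⟩ := x.exists_rep
    obtain ⟨m, b, rfl⟩ := y.exists_rep
    simp only [← cls_fromBlocks]
    rw [← cls_submatrix _ (Equiv.sumComm _ _)]
    congr 1
    ext ( i | i) (j | j) <;> simp [Matrix.fromBlocks]
  nsmul := nsmulRec

instance : IsOrderedAddMonoid (CW A) where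
  add_le_add_left x y h z := by
    obtain ⟨n, a, rfl⟩ := x.exists_rep
    obtain ⟨m, b, rfl⟩ := y.exists_rep
    obtain ⟨l, c, rfl⟩ := z.exists_rep
    simp only [← cls_fromBlocks]
    exact cls_le_cls.2 (MatCuntzLE.fromBlocks (cls_le_cls.1 h) (MatCuntzLE.rfl' c))

theorem CW.zero_le (x : CW A) : 0 ≤ x := by
  obtain ⟨n, a, rfl⟩ := x.exists_rep
  rw [← cls_zero (ι := Fin 0)]
  exact cls_le_cls.2 ⟨fun _ => 0, by simp⟩

theorem cls_conj_le (v : Matrix ι κ A) (b : Matrix κ κ A) : cls (v * b * vᴴ) ≤ cls b :=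
  cls_le_cls.2 (matCuntzLE_conj v b)

theorem cls_add_le (a b : Matrix ι ι A) : cls (a + b) ≤ cls a + cls b := by
  classical
  rw [← cls_fromBlocks]
  have h := cls_conj_le (Matrix.fromCols (1 : Matrix ι ι A) (1 : Matrix ι ι A))
    (Matrix.fromBlocks a 0 0 b)
  have h2 : Matrix.fromCols (1 : Matrix ι ι A) (1 : Matrix ι ι A) * (Matrix.fromBlocks a 0 0 b) *
    (Matrix.fromCols (1 : Matrix ι ι A) (1 : Matrix ι ι A))ᴴ = a + b := by
    rw [Matrix.fromCols_mul_fromBlocks, Matrix.conjTranspose_fromCols_eq_fromRows_conjTranspose,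
      Matrix.fromCols_mul_fromRows]
    simp
  rwa [h2] at h

theorem cls_blockDiagonal'_fin (n : ℕ) (m : Fin n → Type) [∀ j, Fintype (m j)]
    (b : ∀ j, Matrix (m j) (m j) A) :
    cls (Matrix.blockDiagonal' b) = ∑ j, cls (b j) := by
  induction n with
  | zero =>
    simp only [Finset.univ_eq_empty, Finset.sum_empty]
    rw [← cls_zero (ι := Fin 0)]
    rw [← cls_submatrix (0 : Matrix (Fin 0) (Fin 0) A) (Equiv.equivOfIsEmpty (Σ j, m j) (Fin 0))]
    congr 1
    ext i
    exact isEmptyElim i.1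
  | succ n ih =>
    rw [Fin.sum_univ_succ, ← ih (fun j => m j.succ) (fun j => b j.succ), ← cls_fromBlocks]
    let e : (m 0 ⊕ Σ j : Fin n, m j.succ) ≃ Σ j, m j :=
      { toFun := fun x => Sum.elim (fun i => ⟨0, i⟩) (fun i => ⟨i.1.succ, i.2⟩) x
        invFun := fun x => Fin.cases (motive := fun j => m j → (m 0 ⊕ Σ j : Fin n, m j.succ))
          (fun i => Sum.inl i) (fun j i => Sum.inr ⟨j, i⟩) x.1 x.2
        left_inv := by rintro (i | ⟨j, i⟩) <;> rfl
        right_inv := by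
          rintro ⟨j, i⟩
          induction j using Fin.cases <;> rfl }
    rw [← cls_submatrix _ e]
    congr 1
    ext (i | ⟨j, i⟩) (i' | ⟨j', i'⟩)
    · simp [e, Matrix.blockDiagonal'_apply]
    · simp [e, Matrix.blockDiagonal'_apply, (Fin.succ_ne_zero _).symm]
    · simp [e, Matrix.blockDiagonal'_apply]
    · simp only [e, Matrix.submatrix_apply, Equiv.coe_fn_mk, Sum.elim_inr, Matrix.fromBlocks_apply₂₂]
      by_cases h : j = j'
      · subst h; simp [Matrix.blockDiagonal'_apply]
      · rw [Matrix.blockDiagonal'_apply_ne _ _ _ h, Matrix.blockDiagonal'_apply_ne]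
        simpa using h

theorem cls_blockDiagonal (n : ℕ) (b : Fin n → Matrix ι ι A) :
    cls (Matrix.blockDiagonal b) = ∑ j, cls (b j) := by
  rw [← cls_blockDiagonal'_fin n (fun _ => ι), ← Matrix.blockDiagonal'_submatrix_eq_blockDiagonal]
  exact cls_submatrix _ ((Equiv.prodComm _ _).trans (Equiv.sigmaEquivProd _ _).symm)

theorem cls_matRep (k : ℕ) (a : Matrix ι ι A) : cls (matRep k a) = k • cls a := by
  unfold matRep
  rw [cls_blockDiagonal]; simp

end CuntzW


/-! ### Functional calculus lemmas in a unital C*-algebra -/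

section FC

variable {D : Type} [CStarAlgebra D] [PartialOrder D] [StarOrderedRing D]

theorem fc_cut (x : D) (hx : 0 ≤ x) (ε : ℝ) (hε : 0 < ε) :
    ∃ f y : D, 0 ≤ f ∧ 0 ≤ y ∧ f * (x - algebraMap ℝ D ε) * f = y ∧ ‖y - x‖ ≤ 2 * ε := by
  have hsa : IsSelfAdjoint x := IsSelfAdjoint.of_nonneg hx
  have hden : ∀ t : ℝ, 0 < max (t - ε) ε := fun t => lt_max_of_lt_right hε
  have hc1 : Continuous fun t : ℝ => √(max (t - 2 * ε) 0 / max (t - ε) ε) := by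
    refine Continuous.sqrt (Continuous.div ?_ ?_ fun t => (hden t).ne')
    · fun_prop
    · fun_prop
  have hc2 : Continuous fun t : ℝ => max (t - 2 * ε) 0 := by fun_prop
  refine ⟨cfc (fun t : ℝ => √(max (t - 2 * ε) 0 / max (t - ε) ε)) x,
    cfc (fun t : ℝ => max (t - 2 * ε) 0) x, ?_, ?_, ?_, ?_⟩
  · exact cfc_nonneg fun t _ => Real.sqrt_nonneg _
  · exact cfc_nonneg fun t _ => le_max_right _ _
  · have h1 : x - algebraMap ℝ D ε = cfc (fun t : ℝ => t - ε) x := by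
      rw [cfc_sub (fun t : ℝ => t) (fun _ => ε) x, cfc_id' ℝ x, cfc_const ε x]
    rw [h1, ← cfc_mul _ _ x hc1.continuousOn, ← cfc_mul _ _ x _ hc1.continuousOn]
    · congr 1
      ext t
      have h2 : √(max (t - 2 * ε) 0 / max (t - ε) ε) * (t - ε) * √(max (t - 2 * ε) 0 / max (t - ε) ε)
        = (max (t - 2 * ε) 0 / max (t - ε) ε) * (t - ε) := by
        have : 0 ≤ max (t - 2 * ε) 0 / max (t - ε) ε := div_nonneg (le_max_right _ _) (hden t).le
        rw [mul_right_comm, Real.mul_self_sqrt this]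
      rw [h2]
      rcases le_total (t - 2 * ε) 0 with h | h
      · rw [max_eq_right h]; simp
      · have : max (t - ε) ε = t - ε := max_eq_left (by linarith)
        rw [this, div_mul_cancel₀]
        linarith
    · exact (hc1.mul (by fun_prop)).continuousOn
  · nth_rw 2 [← cfc_id' ℝ x]
    rw [← cfc_sub (fun t : ℝ => max (t - 2 * ε) 0) (fun t => t) x hc2.continuousOn]
    refine norm_cfc_le (by positivity) fun t ht => ?_
    have ht0 : 0 ≤ t := spectrum_nonneg_of_nonneg hx ht
    rw [Real.norm_eq_abs, abs_le]
    rcases le_total (t - 2 * ε) 0 with h | h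
    · rw [max_eq_right h]; constructor <;> linarith
    · rw [max_eq_left h]; constructor <;> linarith

theorem fc_le (y z : D) (hy : 0 ≤ y) (hz : 0 ≤ z) (δ : ℝ) (hδ : 0 < δ)
    (h : y ≤ z + algebraMap ℝ D δ) : ∃ R : D, ‖R * z * star R - y‖ ≤ 2 * δ := by
  have hzsa : IsSelfAdjoint z := IsSelfAdjoint.of_nonneg hz
  have hsp : ∀ t ∈ spectrum ℝ z, 0 ≤ t := fun t ht => spectrum_nonneg_of_nonneg hz ht
  have hcG : ContinuousOn (fun t : ℝ => √t / (t + δ)) (spectrum ℝ z) := by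
    refine ContinuousOn.div ?_ ?_ fun t ht => (by have := hsp t ht; positivity)
    · fun_prop
    · fun_prop
  have hcH : ContinuousOn (fun t : ℝ => 1 - t ^ 2 / (t + δ) ^ 2) (spectrum ℝ z) := by
    refine ContinuousOn.sub (by fun_prop) (ContinuousOn.div ?_ ?_ fun t ht => (by have := hsp t ht; positivity))
    · fun_prop
    · fun_prop
  have hcK := hcH.sqrt
  have hnn : ∀ t ∈ spectrum ℝ z, 0 ≤ 1 - t ^ 2 / (t + δ) ^ 2 := by
    intro t ht
    have := hsp t ht
    rw [sub_nonneg, div_le_one (by positivity)]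
    nlinarith
  set G := cfc (fun t : ℝ => √t / (t + δ)) z with hG
  set K := cfc (fun t : ℝ => √(1 - t ^ 2 / (t + δ) ^ 2)) z with hK
  have hGsa : star G = G := (cfc_predicate _ z : IsSelfAdjoint G)
  have hKsa : star K = K := (cfc_predicate _ z : IsSelfAdjoint K)
  set s := CFC.sqrt y with hs
  have hssa : star s = s := (IsSelfAdjoint.of_nonneg (CFC.sqrt_nonneg y)).star_eq
  have hss : s * s = y := CFC.sqrt_mul_sqrt_self y hy
  have hKK : K * K = 1 - G * z * G := by
    have e1 : G * z * G = cfc (fun t : ℝ => t ^ 2 / (t + δ) ^ 2) z := by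
      have e0 : G * z * G = G * cfc (fun t : ℝ => t) z * G := by rw [cfc_id' ℝ z]
      rw [e0, hG, ← cfc_mul _ _ z hcG, ← cfc_mul _ _ z _ hcG]
      · refine cfc_congr fun t ht => ?_
        have h0 := hsp t ht
        have : t + δ ≠ 0 := by positivity
        have h3 := Real.mul_self_sqrt h0
        show √t / (t + δ) * t * (√t / (t + δ)) = t ^ 2 / (t + δ) ^ 2
        rw [div_mul_eq_mul_div, div_mul_div_comm]
        congr 1
        · calc √t * t * √t = (√t * √t) * t := by ring
            _ = t ^ 2 := by rw [h3]; ring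
        · ring
      · exact hcG.mul (by fun_prop)
    rw [e1, ← cfc_one ℝ z, hK, ← cfc_mul _ _ z hcK hcK]
    have e2 : cfc (fun t : ℝ => 1 - t ^ 2 / (t + δ) ^ 2) z =
        cfc (1 : ℝ → ℝ) z - cfc (fun t : ℝ => t ^ 2 / (t + δ) ^ 2) z := by
      have hcc : ContinuousOn (fun t : ℝ => t ^ 2 / (t + δ) ^ 2) (spectrum ℝ z) := by
        refine ContinuousOn.div ?_ ?_ fun t ht => (by have := hsp t ht; positivity)
        · fun_prop
        · fun_prop
      rw [← cfc_sub (1 : ℝ → ℝ) (fun t : ℝ => t ^ 2 / (t + δ) ^ 2) z (by exact continuousOn_const)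
        hcc]
      rfl
    rw [← e2]
    exact cfc_congr fun t ht => Real.mul_self_sqrt (hnn t ht)
  refine ⟨s * G, ?_⟩
  have e3 : s * G * z * star (s * G) - y = - ((s * K) * star (s * K)) := by
    rw [star_mul, star_mul, hGsa, hssa, hKsa]
    calc s * G * z * (G * s) - y = s * (G * z * G) * s - s * s := by rw [hss]; noncomm_ring
      _ = - (s * (1 - G * z * G) * s) := by noncomm_ring
      _ = _ := by rw [← hKK]; noncomm_ring
  rw [e3, norm_neg, CStarRing.norm_self_mul_star, ← CStarRing.norm_star_mul_self, star_mul, hKsa, hssa]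
  have e4 : K * s * (s * K) = K * y * K := by rw [← hss]; noncomm_ring
  rw [e4]
  have hle : K * y * K ≤ K * (z + algebraMap ℝ D δ) * K := by
    have := star_left_conjugate_le_conjugate h K
    rwa [hKsa] at this
  have h0 : 0 ≤ K * y * K := by
    have := star_left_conjugate_nonneg hy K
    rwa [hKsa] at this
  refine (CStarAlgebra.norm_le_norm_of_nonneg_of_le h0 hle).trans ?_
  have e5 : z + algebraMap ℝ D δ = cfc (fun t : ℝ => t + δ) z := by
    rw [cfc_add z (fun t : ℝ => t) (fun _ => δ), cfc_id' ℝ z, cfc_const δ z]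
  rw [e5, hK, ← cfc_mul _ _ z hcK, ← cfc_mul _ _ z _ hcK]
  · refine norm_cfc_le (by positivity) fun t ht => ?_
    have h0 := hsp t ht
    have h3 := Real.mul_self_sqrt (hnn t ht)
    have h4 : √(1 - t ^ 2 / (t + δ) ^ 2) * (t + δ) * √(1 - t ^ 2 / (t + δ) ^ 2)
        = (2 * t * δ + δ ^ 2) / (t + δ) := by
      calc _ = (√(1 - t ^ 2 / (t + δ) ^ 2) * √(1 - t ^ 2 / (t + δ) ^ 2)) * (t + δ) := by ring
        _ = _ := by
          rw [h3]
          have : t + δ ≠ 0 := by positivity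
          field_simp
          ring
    rw [h4, Real.norm_eq_abs, abs_of_nonneg (by positivity), div_le_iff₀ (by positivity)]
    nlinarith
  · exact hcK.mul (by fun_prop)

end FC


/-! ### Positivity and entrywise estimates for matrices over a C*-algebra -/

section MatLemmas

variable {A : Type} [CStarAlgebra A]
variable {ι κ μ : Type} [Fintype ι] [Fintype κ] [Fintype μ]

/-- The entrywise `ℓ¹`-norm of a matrix. -/
noncomputable def l1 (X : Matrix ι κ A) : ℝ := ∑ i, ∑ j, ‖X i j‖

theorem l1_nonneg (X : Matrix ι κ A) : 0 ≤ l1 X :=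
  Finset.sum_nonneg fun _ _ => Finset.sum_nonneg fun _ _ => norm_nonneg _

theorem l1_add_le (X Y : Matrix ι κ A) : l1 (X + Y) ≤ l1 X + l1 Y := by
  unfold l1
  simp only [← Finset.sum_add_distrib]
  exact Finset.sum_le_sum fun i _ => Finset.sum_le_sum fun j _ => norm_add_le _ _

theorem l1_neg (X : Matrix ι κ A) : l1 (-X) = l1 X := by
  simp [l1]

theorem l1_sub_comm (X Y : Matrix ι κ A) : l1 (X - Y) = l1 (Y - X) := by
  rw [← l1_neg, neg_sub]

theorem l1_sub_le (X Y Z : Matrix ι κ A) : l1 (X - Z) ≤ l1 (X - Y) + l1 (Y - Z) := by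
  have := l1_add_le (X - Y) (Y - Z)
  simpa using this

theorem l1_conjTranspose (X : Matrix ι κ A) : l1 Xᴴ = l1 X := by
  unfold l1
  rw [Finset.sum_comm]
  simp

theorem norm_entry_le_l1 (X : Matrix ι κ A) (i : ι) (j : κ) : ‖X i j‖ ≤ l1 X := by
  unfold l1
  refine (Finset.single_le_sum (f := fun j => ‖X i j‖) (fun _ _ => norm_nonneg _)
    (Finset.mem_univ j)).trans ?_
  exact Finset.single_le_sum (f := fun i => ∑ j, ‖X i j‖)
    (fun _ _ => Finset.sum_nonneg fun _ _ => norm_nonneg _) (Finset.mem_univ i)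

theorem l1_le_of_entry (X : Matrix ι κ A) (C : ℝ) (h : ∀ i j, ‖X i j‖ ≤ C) :
    l1 X ≤ Fintype.card ι * (Fintype.card κ * C) := by
  unfold l1
  calc _ ≤ ∑ i : ι, ∑ j : κ, C := Finset.sum_le_sum fun i _ => Finset.sum_le_sum fun j _ => h i j
    _ = _ := by simp

theorem l1_mul_le (X : Matrix ι κ A) (Y : Matrix κ μ A) : l1 (X * Y) ≤ l1 X * l1 Y := by
  unfold l1
  calc ∑ i, ∑ j, ‖(X * Y) i j‖ ≤ ∑ i, ∑ j, ∑ k, ‖X i k‖ * ‖Y k j‖ := by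
        refine Finset.sum_le_sum fun i _ => Finset.sum_le_sum fun j _ => ?_
        rw [Matrix.mul_apply]
        exact (norm_sum_le _ _).trans (Finset.sum_le_sum fun k _ => norm_mul_le _ _)
    _ = ∑ i, ∑ k, ‖X i k‖ * ∑ j, ‖Y k j‖ := by
        refine Finset.sum_congr rfl fun i _ => ?_
        rw [Finset.sum_comm]
        simp [Finset.mul_sum]
    _ ≤ ∑ i, ∑ k, ‖X i k‖ * ∑ k, ∑ j, ‖Y k j‖ := by
        refine Finset.sum_le_sum fun i _ => Finset.sum_le_sum fun k _ => ?_
        refine mul_le_mul_of_nonneg_left ?_ (norm_nonneg _)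
        exact Finset.single_le_sum (f := fun k => ∑ j, ‖Y k j‖)
          (fun _ _ => Finset.sum_nonneg fun _ _ => norm_nonneg _) (Finset.mem_univ k)
    _ = _ := by simp only [Finset.sum_mul]

theorem l1_conj_le (X : Matrix ι κ A) (Y : Matrix κ κ A) :
    l1 (X * Y * Xᴴ) ≤ l1 X * l1 Y * l1 X := by
  refine (l1_mul_le _ _).trans ?_
  rw [l1_conjTranspose]
  exact mul_le_mul_of_nonneg_right (l1_mul_le _ _) (l1_nonneg _)

theorem tendsto_iff_l1 {α : Type} {l : Filter α} {f : α → Matrix ι κ A} {X : Matrix ι κ A} :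
    Tendsto f l (𝓝 X) ↔ Tendsto (fun t => l1 (f t - X)) l (𝓝 0) := by
  constructor
  · intro h
    have hc : Continuous fun Y : Matrix ι κ A => l1 (Y - X) := by
      unfold l1
      refine continuous_finsetSum _ fun i _ => continuous_finsetSum _ fun j _ => ?_
      have : Continuous fun Y : Matrix ι κ A => Y i j := continuous_id.matrix_elem i j
      simp only [Matrix.sub_apply]
      fun_prop
    have := (hc.tendsto X).comp h
    simpa [l1, Function.comp_def] using this
  · intro h
    refine tendsto_pi_nhds.2 fun i => tendsto_pi_nhds.2 fun j => ?_
    rw [tendsto_iff_norm_sub_tendsto_zero]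
    exact squeeze_zero (fun _ => norm_nonneg _) (fun t => norm_entry_le_l1 (f t - X) i j) h

theorem MatCuntzLE.exists_l1 {a : Matrix ι ι A} {b : Matrix κ κ A} (h : MatCuntzLE a b)
    {ε : ℝ} (hε : 0 < ε) : ∃ v : Matrix ι κ A, l1 (v * b * vᴴ - a) < ε := by
  obtain ⟨v, hv⟩ := h
  rw [tendsto_iff_l1] at hv
  obtain ⟨k, hk⟩ := (hv.eventually (gt_mem_nhds hε)).exists
  exact ⟨v k, hk⟩

theorem cls_le_of_approx {a : Matrix ι ι A} {T : CW A}
    (h : ∀ ε : ℝ, 0 < ε → ∃ z : Matrix ι ι A, l1 (z - a) < ε ∧ cls z ≤ T) : cls a ≤ T := by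
  obtain ⟨n, b, rfl⟩ := T.exists_rep
  have h1 : ∀ k : ℕ, ∃ v : Matrix ι (Fin n) A, l1 (v * b * vᴴ - a) < 1 / ((k : ℝ) + 1) := by
    intro k
    have hk : (0 : ℝ) < 1 / ((k : ℝ) + 1) / 2 := by positivity
    obtain ⟨z, hz, hzb⟩ := h _ hk
    obtain ⟨v, hv⟩ := (cls_le_cls.1 hzb).exists_l1 hk
    refine ⟨v, ?_⟩
    have := l1_sub_le (v * b * vᴴ) z a
    linarith
  choose v hv using h1
  rw [cls_le_cls]
  refine ⟨v, tendsto_iff_l1.2 ?_⟩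
  exact squeeze_zero (fun _ => l1_nonneg _) (fun k => (hv k).le)
    tendsto_one_div_add_atTop_nhds_zero_nat

section Generic

variable {D : Type} [CStarAlgebra D] [PartialOrder D] [StarOrderedRing D]

theorem gen_nonneg_iff (x : D) : 0 ≤ x ↔ ∃ c : D, x = star c * c :=
  CStarAlgebra.nonneg_iff_eq_star_mul_self

theorem gen_algebraMap (ε : ℝ) : algebraMap ℝ D ε = (ε : ℂ) • (1 : D) := by
  rw [Algebra.algebraMap_eq_smul_one]
  exact (Complex.coe_smul ε (1 : D)).symm

theorem gen_cut (x : D) (hx : 0 ≤ x) (ε : ℝ) (hε : 0 < ε) :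
    ∃ f y : D, 0 ≤ f ∧ 0 ≤ y ∧ f * (x - (ε : ℂ) • (1 : D)) * f = y ∧ ‖y - x‖ ≤ 2 * ε := by
  rw [← gen_algebraMap]
  exact fc_cut x hx ε hε

theorem gen_le (y z : D) (hy : 0 ≤ y) (hz : 0 ≤ z) (δ : ℝ) (hδ : 0 < δ)
    (h : 0 ≤ z + (δ : ℂ) • (1 : D) - y) : ∃ R : D, ‖R * z * star R - y‖ ≤ 2 * δ := by
  rw [← gen_algebraMap] at h
  exact fc_le y z hy hz δ hδ (sub_nonneg.1 h)

theorem gen_small (x : D) (hx : star x = x) (δ : ℝ) (h : ‖x‖ ≤ δ) :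
    0 ≤ x + (δ : ℂ) • (1 : D) := by
  rw [← gen_algebraMap]
  have hsa : IsSelfAdjoint x := hx
  have h1 := hsa.neg_algebraMap_norm_le_self
  have h2 : algebraMap ℝ D ‖x‖ ≤ algebraMap ℝ D δ := algebraMap_mono _ h
  have := (neg_le_neg h2).trans h1
  rw [← sub_nonneg] at this
  simpa using this

end Generic

section Bridge

variable [DecidableEq ι] [PartialOrder A] [StarOrderedRing A]

theorem matPos_iff_nonneg {X : Matrix ι ι A} :
    MatPos X ↔ 0 ≤ (CStarMatrix.ofMatrix X : CStarMatrix ι ι A) := by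
  exact (gen_nonneg_iff (CStarMatrix.ofMatrix X : CStarMatrix ι ι A)).symm

open CStarMatrix WithCStarModule in
theorem norm_le_l1 (X : Matrix ι ι A) : ‖(CStarMatrix.ofMatrix X : CStarMatrix ι ι A)‖ ≤ l1 X := by
  rw [CStarMatrix.norm_def]
  have e : l1 X = ∑ j, ∑ i, ‖X i j‖ := Finset.sum_comm
  rw [e]
  refine (toCLM (ofMatrix X)).opNorm_le_bound (by positivity) fun v => ?_
  simp only [toCLM_apply_eq_sum, Finset.sum_mul]
  apply pi_norm_le_sum_norm _ |>.trans
  gcongr with i _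
  apply norm_sum_le _ _ |>.trans
  gcongr with j _
  apply norm_mul_le _ _ |>.trans
  rw [mul_comm]
  gcongr
  · exact le_rfl
  · exact norm_apply_le_norm v j

theorem l1_le_norm (X : Matrix ι ι A) :
    l1 X ≤ Fintype.card ι * (Fintype.card ι * ‖(CStarMatrix.ofMatrix X : CStarMatrix ι ι A)‖) :=
  l1_le_of_entry X _ fun i j =>
    CStarMatrix.norm_entry_le_norm (M := (CStarMatrix.ofMatrix X : CStarMatrix ι ι A))

end Bridge

theorem MatPos.conjTranspose_eq {X : Matrix ι ι A} (h : MatPos X) : Xᴴ = X := by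
  obtain ⟨c, rfl⟩ := h
  simp [Matrix.conjTranspose_mul]

theorem MatPos.add {X Y : Matrix ι ι A} (hX : MatPos X) (hY : MatPos Y) : MatPos (X + Y) := by
  classical
  letI := CStarAlgebra.spectralOrder A
  letI := CStarAlgebra.spectralOrderedRing A
  rw [matPos_iff_nonneg] at *
  exact add_nonneg hX hY

theorem matPos_zero : MatPos (0 : Matrix ι ι A) := ⟨0, by simp⟩

theorem matPos_sum {α : Type} (s : Finset α) (X : α → Matrix ι ι A) (h : ∀ i ∈ s, MatPos (X i)) :
    MatPos (∑ i ∈ s, X i) := by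
  classical
  induction s using Finset.induction_on with
  | empty => simpa using matPos_zero
  | insert i s hi ih =>
    rw [Finset.sum_insert hi]
    exact (h i (by simp)).add (ih fun j hj => h j (by simp [hj]))

theorem matPos_rect (Y : Matrix κ ι A) : MatPos (Yᴴ * Y) := by
  classical
  rcases isEmpty_or_nonempty ι with hι | ⟨⟨i0⟩⟩
  · exact ⟨0, by ext i; exact hι.elim i⟩
  have e : Yᴴ * Y = ∑ k : κ, (Matrix.of fun i j => star (Y k i) * Y k j) := by
    ext i j
    simp [Matrix.mul_apply, Matrix.sum_apply]
  rw [e]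
  refine matPos_sum _ _ fun k _ => ⟨Matrix.of fun i j => if i = i0 then Y k j else 0, ?_⟩
  ext i j
  simp [Matrix.mul_apply, apply_ite star]

theorem MatPos.conj {X : Matrix κ κ A} (hX : MatPos X) (v : Matrix ι κ A) :
    MatPos (v * X * vᴴ) := by
  obtain ⟨c, rfl⟩ := hX
  have := matPos_rect (c * vᴴ)
  simpa [Matrix.conjTranspose_mul, Matrix.mul_assoc] using this

theorem mat_cut [DecidableEq ι] {x : Matrix ι ι A} (hx : MatPos x) {ε : ℝ} (hε : 0 < ε) :
    ∃ f y : Matrix ι ι A, MatPos f ∧ MatPos y ∧ f * (x - (ε : ℂ) • (1 : Matrix ι ι A)) * f = y ∧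
      l1 (y - x) ≤ Fintype.card ι * (Fintype.card ι * (2 * ε)) := by
  letI := CStarAlgebra.spectralOrder A
  letI := CStarAlgebra.spectralOrderedRing A
  rw [matPos_iff_nonneg] at hx
  obtain ⟨f, y, hf, hy, h1, h2⟩ := gen_cut _ hx ε hε
  refine ⟨CStarMatrix.ofMatrix.symm f, CStarMatrix.ofMatrix.symm y, matPos_iff_nonneg.2 hf,
    matPos_iff_nonneg.2 hy, h1, (l1_le_norm _).trans ?_⟩
  gcongr
  exact h2

theorem mat_le [DecidableEq ι] {y z : Matrix ι ι A} (hy : MatPos y) (hz : MatPos z) {δ : ℝ}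
    (hδ : 0 < δ) (h : MatPos (z + (δ : ℂ) • (1 : Matrix ι ι A) - y)) :
    ∃ R : Matrix ι ι A, l1 (R * z * Rᴴ - y) ≤ Fintype.card ι * (Fintype.card ι * (2 * δ)) := by
  letI := CStarAlgebra.spectralOrder A
  letI := CStarAlgebra.spectralOrderedRing A
  rw [matPos_iff_nonneg] at hy hz h
  obtain ⟨R, hR⟩ := gen_le _ _ hy hz δ hδ h
  refine ⟨CStarMatrix.ofMatrix.symm R, (l1_le_norm _).trans ?_⟩
  gcongr
  exact hR

theorem mat_small [DecidableEq ι] {X : Matrix ι ι A} (hX : Xᴴ = X) {δ : ℝ} (h : l1 X ≤ δ) :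
    MatPos (X + (δ : ℂ) • (1 : Matrix ι ι A)) := by
  letI := CStarAlgebra.spectralOrder A
  letI := CStarAlgebra.spectralOrderedRing A
  rw [matPos_iff_nonneg]
  exact gen_small (CStarMatrix.ofMatrix X : CStarMatrix ι ι A) hX δ ((norm_le_l1 X).trans h)

/-- Domination up to arbitrarily small errors implies Cuntz subequivalence. -/
theorem cls_le_of_matPos_sub [DecidableEq ι] {y z : Matrix ι ι A} (hy : MatPos y) (hz : MatPos z)
    (h : MatPos (z - y)) : cls y ≤ cls z := by
  refine cls_le_of_approx fun ε hε => ?_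
  set C : ℝ := Fintype.card ι * (Fintype.card ι * 2) + 1 with hC
  have hCpos : 0 < C := by positivity
  have hδ : 0 < ε / C := by positivity
  have hp : MatPos (z + ((ε / C : ℝ) : ℂ) • (1 : Matrix ι ι A) - y) := by
    have h2 := h.add (mat_small (X := (0 : Matrix ι ι A)) (δ := ε / C) (by simp) (by simp [l1, hδ.le]))
    convert h2 using 1
    abel
  obtain ⟨R, hR⟩ := mat_le hy hz hδ hp
  refine ⟨R * z * Rᴴ, hR.trans_lt ?_, cls_conj_le _ _⟩
  have : (Fintype.card ι : ℝ) * (Fintype.card ι * (2 * (ε / C))) = (C - 1) * (ε / C) := by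
    rw [hC]; ring
  rw [this]
  have : C * (ε / C) = ε := by field_simp
  nlinarith

end MatLemmas


/-! ### Completely positive maps on matrices -/

section CP

variable {A B : Type} [CStarAlgebra A] [CStarAlgebra B]
variable {ι κ μ ν : Type} [Fintype ι] [Fintype κ] [Fintype μ] [Fintype ν]

/-- The `1 × 1` matrix with entry `x`. -/
def sg (x : A) : Matrix Unit Unit A := Matrix.of fun _ _ => x

theorem IsCPC.map_star {φ : A →ₗ[ℂ] B} (h : IsCPC φ) (x : A) : φ (star x) = star (φ x) := by
  let _ := CStarAlgebra.spectralOrder A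
  have _ := CStarAlgebra.spectralOrderedRing A
  have hx : x ∈ Submodule.span ℂ {a : A | 0 ≤ a} := by
    rw [CStarAlgebra.span_nonneg]; trivial
  induction hx using Submodule.span_induction with
  | mem x hx =>
    have hx' : (0 : A) ≤ x := hx
    obtain ⟨d, hd⟩ := (gen_nonneg_iff x).1 hx'
    have h1 : MatPos (Matrix.of fun _ _ : Fin 1 => x) :=
      ⟨Matrix.of fun _ _ => d, by ext; simp [Matrix.mul_apply, hd]⟩
    have h2 := (h.2 1 _ h1).conjTranspose_eq
    have h3 := congrFun (congrFun h2 0) 0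
    simp only [Matrix.conjTranspose_apply, Matrix.map_apply, Matrix.of_apply] at h3
    rw [h3, (IsSelfAdjoint.of_nonneg hx').star_eq]
  | zero => simp
  | add x y _ _ hx hy => simp [hx, hy]
  | smul c x _ hx => simp [hx]

theorem IsCPC.map_conjTranspose {φ : A →ₗ[ℂ] B} (h : IsCPC φ) (X : Matrix ι κ A) :
    Xᴴ.map φ = (X.map φ)ᴴ := by
  ext i j
  simp [h.map_star]

theorem IsCPC.l1_map_le {φ : A →ₗ[ℂ] B} (h : IsCPC φ) (X : Matrix ι κ A) :
    l1 (X.map φ) ≤ l1 X :=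
  Finset.sum_le_sum fun _ _ => Finset.sum_le_sum fun _ _ => h.1 _

theorem matmap_sub (φ : A →ₗ[ℂ] B) (X Y : Matrix ι κ A) : (X - Y).map φ = X.map φ - Y.map φ := by
  ext; simp

theorem matmap_smul (φ : A →ₗ[ℂ] B) (c : ℂ) (X : Matrix ι κ A) : (c • X).map φ = c • X.map φ := by
  ext; simp

theorem map_matRep (φ : A →ₗ[ℂ] B) (k : ℕ) (X : Matrix ι ι A) :
    (matRep k X).map φ = matRep k (X.map φ) := by
  ext ⟨i, s⟩ ⟨j, t⟩
  simp only [matRep, Matrix.map_apply, Matrix.blockDiagonal_apply]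
  split_ifs <;> simp

theorem matRep_mul (k : ℕ) (X Y : Matrix ι ι A) : matRep k (X * Y) = matRep k X * matRep k Y :=
  Matrix.blockDiagonal_mul _ _

theorem matRep_sub (k : ℕ) (X Y : Matrix ι ι A) : matRep k (X - Y) = matRep k X - matRep k Y :=
  Matrix.blockDiagonal_sub _ _

theorem matRep_smul_one [DecidableEq ι] (k : ℕ) (c : ℂ) :
    matRep k (c • (1 : Matrix ι ι A)) = c • 1 := by
  have h1 : matRep k (c • (1 : Matrix ι ι A)) = c • matRep k (1 : Matrix ι ι A) :=
    Matrix.blockDiagonal_smul c _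
  rw [h1]
  congr 1
  exact Matrix.blockDiagonal_one

theorem matRep_conjTranspose (k : ℕ) (X : Matrix ι ι A) : matRep k Xᴴ = (matRep k X)ᴴ :=
  (Matrix.blockDiagonal_conjTranspose _).symm

theorem MatPos.matRep {X : Matrix ι ι A} (h : MatPos X) (k : ℕ) : MatPos (matRep k X) := by
  obtain ⟨c, rfl⟩ := h
  exact ⟨_root_.matRep k c, by rw [matRep_mul, matRep_conjTranspose]⟩

theorem l1_matRep (k : ℕ) (X : Matrix ι ι A) : l1 (matRep k X) = k * l1 X := by
  unfold l1 matRep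
  simp only [Fintype.sum_prod_type, Matrix.blockDiagonal_apply, apply_ite norm, norm_zero,
    Finset.sum_ite_eq, Finset.mem_univ, if_true, Finset.sum_const, Finset.card_univ,
    Fintype.card_fin, nsmul_eq_mul, Finset.mul_sum]

theorem l1_blockDiagonal' {n : ℕ} {m : Fin n → Type} [∀ j, Fintype (m j)]
    (b : ∀ j, Matrix (m j) (m j) A) : l1 (Matrix.blockDiagonal' b) = ∑ j, l1 (b j) := by
  unfold l1
  simp only [Fintype.sum_sigma, Matrix.blockDiagonal'_apply, apply_dite norm, norm_zero]
  refine Finset.sum_congr rfl fun j _ => Finset.sum_congr rfl fun i _ => ?_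
  rw [Finset.sum_eq_single j]
  · simp
  · intro j' _ hj'
    simp [hj'.symm]
  · simp

/-- Approximate multiplicativity of a linear map at matrix level. -/
theorem l1_mul_map_le (φ : A →ₗ[ℂ] B) (X : Matrix ι κ A) (Y : Matrix κ μ A) (η : ℝ)
    (h : ∀ i j k, ‖φ (X i j) * φ (Y j k) - φ (X i j * Y j k)‖ ≤ η) :
    l1 (X.map φ * Y.map φ - (X * Y).map φ) ≤
      Fintype.card ι * (Fintype.card μ * (Fintype.card κ * η)) := by
  refine l1_le_of_entry _ _ fun i k => ?_
  simp only [Matrix.sub_apply, Matrix.mul_apply, Matrix.map_apply, map_sum,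
    ← Finset.sum_sub_distrib]
  refine (norm_sum_le _ _).trans ((Finset.sum_le_sum fun j _ => h i j k).trans ?_)
  simp

/-- Asymptotic multiplicativity on matrices. -/
theorem tendsto_mul_map {φ : ℕ → (A →ₗ[ℂ] B)}
    (h : ∀ x y, Tendsto (fun n => ‖φ n (x * y) - φ n x * φ n y‖) atTop (𝓝 0))
    (X : Matrix ι κ A) (Y : Matrix κ μ A) :
    Tendsto (fun n => l1 (X.map (φ n) * Y.map (φ n) - (X * Y).map (φ n))) atTop (𝓝 0) := by
  have h1 : Tendsto (fun n => ∑ i : ι, ∑ k : μ, ∑ j : κ,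
      ‖φ n (X i j * Y j k) - φ n (X i j) * φ n (Y j k)‖) atTop (𝓝 0) := by
    have := tendsto_finsetSum (Finset.univ : Finset ι) fun i _ =>
      tendsto_finsetSum (Finset.univ : Finset μ) fun k _ =>
      tendsto_finsetSum (Finset.univ : Finset κ) fun j _ => h (X i j) (Y j k)
    simpa using this
  refine squeeze_zero (fun _ => l1_nonneg _) (fun n => ?_) h1
  refine Finset.sum_le_sum fun i _ => Finset.sum_le_sum fun k _ => ?_
  simp only [Matrix.sub_apply, Matrix.mul_apply, Matrix.map_apply, map_sum,
    ← Finset.sum_sub_distrib]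
  refine (norm_sum_le _ _).trans (Finset.sum_le_sum fun j _ => ?_)
  rw [norm_sub_rev]

theorem l1_mul3_map_le {φ : A →ₗ[ℂ] B} (hφ : IsCPC φ) (X : Matrix ι κ A) (Y : Matrix κ μ A)
    (Z : Matrix μ ν A) :
    l1 (X.map φ * Y.map φ * Z.map φ - (X * Y * Z).map φ) ≤
      l1 (X.map φ * Y.map φ - (X * Y).map φ) * l1 Z +
        l1 ((X * Y).map φ * Z.map φ - (X * Y * Z).map φ) := by
  have e : X.map φ * Y.map φ * Z.map φ - (X * Y * Z).map φ =
      (X.map φ * Y.map φ - (X * Y).map φ) * Z.map φ +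
        ((X * Y).map φ * Z.map φ - (X * Y * Z).map φ) := by
    rw [Matrix.sub_mul]; abel
  rw [e]
  refine (l1_add_le _ _).trans ?_
  gcongr
  exact (l1_mul_le _ _).trans (mul_le_mul_of_nonneg_left (hφ.l1_map_le Z) (l1_nonneg _))

theorem tendsto_mul3_map {φ : ℕ → (A →ₗ[ℂ] B)} (hφ : ∀ n, IsCPC (φ n))
    (h : ∀ x y, Tendsto (fun n => ‖φ n (x * y) - φ n x * φ n y‖) atTop (𝓝 0))
    (X : Matrix ι κ A) (Y : Matrix κ μ A) (Z : Matrix μ ν A) :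
    Tendsto (fun n => l1 (X.map (φ n) * Y.map (φ n) * Z.map (φ n) - (X * Y * Z).map (φ n)))
      atTop (𝓝 0) := by
  refine squeeze_zero (fun _ => l1_nonneg _) (fun n => l1_mul3_map_le (hφ n) X Y Z) ?_
  simpa using ((tendsto_mul_map h X Y).mul_const (l1 Z)).add (tendsto_mul_map h (X * Y) Z)

/-- The comparison step inside the algebra `B`. -/
theorem comparison_step {N : ℕ} (hN : NComparison B N) {na : ℕ} {mb : Fin (N + 1) → ℕ}
    {a : Matrix (Fin na) (Fin na) B} {x : ∀ j, Matrix (Fin (mb j)) (Fin (mb j)) B}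
    (ha : MatPos a) (hx : ∀ j, MatPos (x j)) (k : Fin (N + 1) → ℕ) (hk : ∀ j, 1 ≤ k j)
    (V : ∀ j, Matrix (Fin na × Fin (k j + 1)) (Fin (mb j) × Fin (k j)) B) {ε δ : ℝ}
    (hε : 0 < ε) (hδ : 0 < δ)
    (hV : ∀ j, l1 (V j * matRep (k j) (x j) * (V j)ᴴ - matRep (k j + 1) a) ≤ ε)
    (hVδ : ∀ j, l1 (V j) * (k j * (mb j * (mb j * (2 * δ)))) * l1 (V j) ≤ ε) :
    ∃ (e y : ∀ j, Matrix (Fin (mb j)) (Fin (mb j)) B)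
      (w : Matrix (Fin na) ((j : Fin (N + 1)) × Fin (mb j)) B),
      (∀ j, MatPos (e j)) ∧ (∀ j, MatPos (y j)) ∧
      (∀ j, e j * (x j - (δ : ℂ) • 1) * e j = y j) ∧
      l1 (w * Matrix.blockDiagonal' y * wᴴ - a) ≤ na * (na * (4 * ε)) + ε := by
  have hc := fun j => mat_cut (hx j) hδ
  choose e y he hy hey hyl using hc
  obtain ⟨f, ã, hf, hã, hfa, hfl⟩ := mat_cut ha (show 0 < 2 * ε by positivity)
  have key : ∀ j, MatCuntzLE (matRep (k j + 1) ã) (matRep (k j) (y j)) := by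
    intro j
    rw [← cls_le_cls]
    set F := matRep (k j + 1) f with hF
    have hFs : Fᴴ = F := (hf.matRep _).conjTranspose_eq
    set Q := V j * matRep (k j) (y j) * (V j)ᴴ with hQ
    have hQp : MatPos Q := ((hy j).matRep _).conj _
    have hd : l1 (Q - matRep (k j + 1) a) ≤ 2 * ε := by
      have h1 := l1_sub_le Q (V j * matRep (k j) (x j) * (V j)ᴴ) (matRep (k j + 1) a)
      have h2 : Q - V j * matRep (k j) (x j) * (V j)ᴴ =
          V j * matRep (k j) (y j - x j) * (V j)ᴴ := by
        rw [matRep_sub, Matrix.mul_sub, Matrix.sub_mul]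
      have h3 : l1 (V j * matRep (k j) (y j - x j) * (V j)ᴴ) ≤ ε := by
        refine (l1_conj_le _ _).trans (le_trans ?_ (hVδ j))
        have := hyl j
        simp only [Fintype.card_fin] at this
        rw [l1_matRep]
        have h0 := l1_nonneg (V j)
        gcongr
      rw [h2] at h1
      linarith [hV j]
    have hsa : (Q - matRep (k j + 1) a)ᴴ = Q - matRep (k j + 1) a := by
      rw [Matrix.conjTranspose_sub, hQp.conjTranspose_eq, (ha.matRep _).conjTranspose_eq]
    have hp := (mat_small hsa hd).conj F
    rw [hFs] at hp
    have e1 : F * (Q - matRep (k j + 1) a + ((2 * ε : ℝ) : ℂ) • 1) * F =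
        F * Q * F - matRep (k j + 1) ã := by
      rw [← hfa, matRep_mul, matRep_mul, matRep_sub, matRep_smul_one, ← hF]
      simp only [Matrix.mul_sub, Matrix.sub_mul, Matrix.mul_add, Matrix.add_mul]
      abel
    rw [e1] at hp
    have hFQ : MatPos (F * Q * F) := by
      have := hQp.conj F
      rwa [hFs] at this
    refine (cls_le_of_matPos_sub (hã.matRep _) hFQ hp).trans ?_
    have := cls_conj_le F Q
    rw [hFs] at this
    exact this.trans (cls_conj_le _ _)
  have hfin := hN na mb ã y hã hy fun j => ⟨k j, hk j, key j⟩
  obtain ⟨w, hw⟩ := hfin.exists_l1 hε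
  refine ⟨e, y, w, he, hy, hey, ?_⟩
  have := l1_sub_le (w * Matrix.blockDiagonal' y * wᴴ) ã a
  simp only [Fintype.card_fin] at hfl
  have e2 : 2 * (2 * ε) = 4 * ε := by ring
  rw [e2] at hfl
  linarith

/-- Pulling back a cut-down from `B` to `A`. -/
theorem pullback_step {m : ℕ} {b : Matrix (Fin m) (Fin m) A} {x e y : Matrix (Fin m) (Fin m) B}
    {β : ℕ → (B →ₗ[ℂ] A)} {γ : ℕ → (A →ₗ[ℂ] A)} (hβ : ∀ n, IsCPC (β n)) (hγ : ∀ n, IsCPC (γ n))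
    (horth : ∀ (n : ℕ) (x : A) (b : B), γ n x * β n b = 0 ∧ β n b * γ n x = 0)
    (hmul : ∀ x y, Tendsto (fun n => ‖β n (x * y) - β n x * β n y‖) atTop (𝓝 0))
    (hb : MatPos b) (hx : MatPos x) (he : MatPos e) (hy : MatPos y) {δ : ℝ}
    (hey : e * (x - (δ : ℂ) • 1) * e = y)
    (happ : ∀ n, l1 (b - b.map (γ n) - x.map (β n)) ≤ δ) {θ : ℝ} (hθ : 0 < θ) :
    ∀ᶠ n in atTop, ∃ R : Matrix (Fin m) (Fin m) A, l1 (R * b * Rᴴ - y.map (β n)) ≤ θ := by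
  set C : ℝ := m * (m * 2) + 1 with hC
  have hCpos : 0 < C := by positivity
  have hθ' : 0 < θ / C := by positivity
  have hlim : Tendsto (fun n => l1 (e.map (β n) * x.map (β n) * e.map (β n) -
      (e * x * e).map (β n)) + ‖(δ : ℂ)‖ * l1 (e.map (β n) * e.map (β n) - (e * e).map (β n)))
      atTop (𝓝 0) := by
    simpa using (tendsto_mul3_map hβ hmul e x e).add
      ((tendsto_mul_map hmul e e).const_mul ‖(δ : ℂ)‖)
  filter_upwards [hlim.eventually (gt_mem_nhds hθ')] with n hn
  set E := e.map (β n) with hE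
  set X := x.map (β n) with hX
  set Y := y.map (β n) with hY
  have hEs : Eᴴ = E := ((hβ n).2 _ _ he).conjTranspose_eq
  have hXs : Xᴴ = X := ((hβ n).2 _ _ hx).conjTranspose_eq
  have hYp : MatPos Y := (hβ n).2 _ _ hy
  have hGs : (b.map (γ n))ᴴ = b.map (γ n) := ((hγ n).2 _ _ hb).conjTranspose_eq
  have h1 := (mat_small (X := b - b.map (γ n) - X)
    (by simp only [Matrix.conjTranspose_sub, hb.conjTranspose_eq, hGs, hXs]) (happ n)).conj E
  rw [hEs] at h1
  have hEG : E * b.map (γ n) = 0 := by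
    ext i j
    simp [hE, Matrix.mul_apply, (horth _ _ _).2]
  set Dn := E * X * E - (δ : ℂ) • (E * E) - Y with hDn
  have hDl : l1 Dn ≤ θ / C := by
    have e1 : Dn = (E * X * E - (e * x * e).map (β n)) +
        -((δ : ℂ) • (E * E - (e * e).map (β n))) := by
      rw [hDn, hY, ← hey]
      have : e * (x - (δ : ℂ) • 1) * e = e * x * e - (δ : ℂ) • (e * e) := by
        simp [Matrix.mul_sub, Matrix.sub_mul]
      rw [this, matmap_sub, matmap_smul, smul_sub]
      abel
    rw [e1]
    refine (l1_add_le _ _).trans (le_trans ?_ hn.le)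
    rw [l1_neg]
    gcongr
    unfold l1
    simp only [Matrix.smul_apply, norm_smul, Finset.mul_sum]
    exact le_rfl
  have hDs : Dnᴴ = Dn := by
    simp only [hDn, Matrix.conjTranspose_sub, Matrix.conjTranspose_mul, hEs, hXs,
      hYp.conjTranspose_eq, Matrix.conjTranspose_smul, Matrix.mul_assoc]
    simp
  have h2 := h1.add (mat_small hDs hDl)
  have e2 : E * (b - b.map (γ n) - X + (δ : ℂ) • 1) * E + (Dn + ((θ / C : ℝ) : ℂ) • 1) =
      E * b * E + ((θ / C : ℝ) : ℂ) • 1 - Y := by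
    simp only [Matrix.mul_sub, Matrix.sub_mul, Matrix.mul_add, Matrix.add_mul, hEG, hDn,
      Matrix.zero_mul, Matrix.mul_smul, Matrix.smul_mul, Matrix.mul_one]
    abel
  rw [e2] at h2
  have hEb : MatPos (E * b * E) := by
    have := hb.conj E
    rwa [hEs] at this
  obtain ⟨R, hR⟩ := mat_le hYp hEb hθ' h2
  refine ⟨R * E, ?_⟩
  have e3 : R * E * b * (R * E)ᴴ = R * (E * b * E) * Rᴴ := by
    rw [Matrix.conjTranspose_mul, hEs]; simp only [Matrix.mul_assoc]
  rw [e3]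
  refine hR.trans ?_
  simp only [Fintype.card_fin]
  have h4 : (m : ℝ) * (m * (2 * (θ / C))) = (C - 1) * (θ / C) := by rw [hC]; ring
  have h5 : C * (θ / C) = θ := by field_simp
  rw [h4]; nlinarith

theorem cls_diagonal (n : ℕ) (g : A) :
    cls (Matrix.diagonal fun _ : Fin n => g) = n • cls (sg g) := by
  rw [← cls_matRep, ← cls_submatrix _ (Equiv.punitProd (Fin n)).symm]
  congr 1

theorem CuntzLE.cls_sg {a b : A} (h : CuntzLE a b) : cls (sg a) ≤ cls (sg b) := by
  obtain ⟨v, hv⟩ := h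
  rw [cls_le_cls]
  refine ⟨fun k => sg (v k), ?_⟩
  refine tendsto_pi_nhds.2 fun i => tendsto_pi_nhds.2 fun j => ?_
  simpa [sg, Matrix.mul_apply] using hv

theorem cls_smul_le (r : ℝ) (hr : 0 ≤ r) (X : Matrix ι ι A) : cls ((r : ℂ) • X) ≤ cls X := by
  classical
  have := cls_conj_le (((√r : ℝ) : ℂ) • (1 : Matrix ι ι A)) X
  convert this using 2
  simp only [Matrix.conjTranspose_smul, Matrix.conjTranspose_one, Matrix.smul_mul, Matrix.one_mul,
    Matrix.mul_smul, Matrix.mul_one, smul_smul]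
  congr 1
  rw [Complex.star_def, Complex.conj_ofReal, ← Complex.ofReal_mul, Real.mul_self_sqrt hr]

theorem remainder_step {na : ℕ} {a : Matrix (Fin na) (Fin na) A} (ha : MatPos a)
    {γ : A →ₗ[ℂ] B} (hγ : IsCPC γ) : cls (a.map γ) ≤ na • cls (sg (γ 1)) := by
  have h1 := mat_small (X := -a) (δ := l1 a) (by simp [ha.conjTranspose_eq]) (by rw [l1_neg])
  have h2 := hγ.2 _ _ h1
  have e0 : (1 : Matrix (Fin na) (Fin na) A).map γ = Matrix.diagonal fun _ => γ 1 := by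
    ext i j
    simp only [Matrix.map_apply, Matrix.one_apply, Matrix.diagonal_apply]
    split_ifs <;> simp
  have e1 : (-a + ((l1 a : ℝ) : ℂ) • (1 : Matrix (Fin na) (Fin na) A)).map γ =
      ((l1 a : ℝ) : ℂ) • (Matrix.diagonal fun _ => γ 1) - a.map γ := by
    rw [← e0]
    ext i j
    simp
    abel
  rw [e1] at h2
  have hap := hγ.2 _ _ ha
  have h3 : MatPos (((l1 a : ℝ) : ℂ) • (Matrix.diagonal fun _ : Fin na => γ 1)) := by
    have := h2.add hap
    simpa using this
  refine (cls_le_of_matPos_sub hap h3 h2).trans ?_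
  refine (cls_smul_le _ (l1_nonneg _) _).trans ?_
  rw [cls_diagonal]

end CP


/-! ### The main approximation argument -/

theorem main_claim (P : BundledCStarAlgebra → Prop) (N : ℕ)
    (hP : ∀ B : BundledCStarAlgebra, P B → NComparison B.carrier N)
    (A : Type) [CStarAlgebra A] (hA : AsympTraciallyIn P A)
    {na : ℕ} {mb : Fin (N + 1) → ℕ}
    {a : Matrix (Fin na) (Fin na) A} {b : ∀ j, Matrix (Fin (mb j)) (Fin (mb j)) A}
    (ha : MatPos a) (hb : ∀ j, MatPos (b j))
    (hab : ∀ j, ∃ k : ℕ, 1 ≤ k ∧ MatCuntzLE (matRep (k + 1) a) (matRep k (b j)))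
    {c : A} (hc : ∃ d : A, c = star d * d) (hc0 : c ≠ 0) :
    cls a ≤ ∑ j, cls (b j) + na • cls (sg c) := by
  classical
  refine cls_le_of_approx fun ε hε => ?_
  obtain ⟨ε1, hε1, hε1'⟩ : ∃ ε1 : ℝ, 0 < ε1 ∧
      (na * (na * (4 * (2 * ε1))) + 2 * ε1) + ε1 + ε1 + ε1 < ε := by
    set C : ℝ := na * (na * 8) + 6 with hC
    have hCp : 0 < C := by positivity
    refine ⟨ε / C, by positivity, ?_⟩
    have h4 : (na : ℝ) * (na * (4 * (2 * (ε / C)))) + 2 * (ε / C) + ε / C + ε / C + ε / C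
      = (C - 1) * (ε / C) := by rw [hC]; ring
    have h5 : C * (ε / C) = ε := by field_simp
    have h6 : 0 < ε / C := by positivity
    rw [h4]; nlinarith
  choose k hk hkab using hab
  have hv := fun j => (hkab j).exists_l1 hε1
  choose v hv using hv
  -- choice of `δ`
  have hδ : ∀ᶠ δ : ℝ in 𝓝[>] 0, ∀ j, l1 (v j) * (k j * (mb j * (mb j * (2 * δ)))) * l1 (v j) ≤ ε1 := by
    refine Filter.eventually_all.2 fun j => ?_
    have : Tendsto (fun δ : ℝ => l1 (v j) * (k j * (mb j * (mb j * (2 * δ)))) * l1 (v j))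
        (𝓝[>] 0) (𝓝 0) := by
      have hcont : Continuous fun δ : ℝ =>
        l1 (v j) * (k j * (mb j * (mb j * (2 * δ)))) * l1 (v j) := by fun_prop
      have := hcont.tendsto 0
      simp only [mul_zero, zero_mul] at this
      exact this.mono_left nhdsWithin_le_nhds
    exact (this.eventually (gt_mem_nhds hε1)).mono fun _ h => h.le
  obtain ⟨δ, hδ, hδpos⟩ := (hδ.and self_mem_nhdsWithin).exists
  have hδpos : 0 < δ := hδpos
  -- choice of `η`
  have hη : ∀ᶠ η : ℝ in 𝓝[>] 0, (∀ j, (mb j : ℝ) * (mb j * η) ≤ δ) ∧ ((na : ℝ) * (na * η) ≤ ε1) ∧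
      ∀ j, ((na * (k j + 1) : ℕ) : ℝ) * (((mb j * k j : ℕ) : ℝ) * (((mb j * k j : ℕ) : ℝ) * η))
        * l1 (v j)ᴴ + ((na * (k j + 1) : ℕ) : ℝ) * (((na * (k j + 1) : ℕ) : ℝ) *
          (((mb j * k j : ℕ) : ℝ) * η)) ≤ ε1 := by
    have aux : ∀ (f : ℝ → ℝ) (t : ℝ), Continuous f → f 0 = 0 → 0 < t →
        ∀ᶠ η : ℝ in 𝓝[>] 0, f η ≤ t := by
      intro f t hf hf0 ht
      have := hf.tendsto 0
      rw [hf0] at this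
      exact ((this.mono_left nhdsWithin_le_nhds).eventually (gt_mem_nhds ht)).mono fun _ h => h.le
    refine Filter.Eventually.and ?_ (Filter.Eventually.and ?_ ?_)
    · exact Filter.eventually_all.2 fun j => aux _ _ (by fun_prop) (by simp) hδpos
    · exact aux _ _ (by fun_prop) (by simp) hε1
    · exact Filter.eventually_all.2 fun j => aux _ _ (by fun_prop) (by simp) hε1
  obtain ⟨η, ⟨hη1, hη2, hη3⟩, hηpos⟩ := (hη.and self_mem_nhdsWithin).exists
  have hηpos : 0 < η := hηpos
  -- the finite set
  let ent : ∀ {ι κ : Type} [Fintype ι] [Fintype κ], Matrix ι κ A → Finset A :=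
    fun {ι κ} _ _ X => (Finset.univ : Finset (ι × κ)).image fun p => X p.1 p.2
  have hent : ∀ {ι κ : Type} [Fintype ι] [Fintype κ] (X : Matrix ι κ A) (i : ι) (j : κ),
      X i j ∈ ent X := by
    intro ι κ _ _ X i j
    exact Finset.mem_image.2 ⟨(i, j), Finset.mem_univ _, rfl⟩
  let F : Finset A := ent a ∪ Finset.univ.biUnion fun j =>
    ent (b j) ∪ ent (v j) ∪ ent (matRep (k j) (b j)) ∪ ent (v j * matRep (k j) (b j)) ∪ ent (v j)ᴴ
  have hFa : ∀ i i', a i i' ∈ F := fun i i' => Finset.mem_union_left _ (hent a i i')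
  have hFb : ∀ j i i', b j i i' ∈ F := fun j i i' => by
    refine Finset.mem_union_right _ (Finset.mem_biUnion.2 ⟨j, Finset.mem_univ _, ?_⟩)
    simp only [Finset.mem_union]
    exact Or.inl (Or.inl (Or.inl (Or.inl (hent _ _ _))))
  have hFv : ∀ j i i', v j i i' ∈ F := fun j i i' => by
    refine Finset.mem_union_right _ (Finset.mem_biUnion.2 ⟨j, Finset.mem_univ _, ?_⟩)
    simp only [Finset.mem_union]
    exact Or.inl (Or.inl (Or.inl (Or.inr (hent _ _ _))))
  have hFr : ∀ j i i', matRep (k j) (b j) i i' ∈ F := fun j i i' => by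
    refine Finset.mem_union_right _ (Finset.mem_biUnion.2 ⟨j, Finset.mem_univ _, ?_⟩)
    simp only [Finset.mem_union]
    exact Or.inl (Or.inl (Or.inr (hent _ _ _)))
  have hFvr : ∀ j i i', (v j * matRep (k j) (b j)) i i' ∈ F := fun j i i' => by
    refine Finset.mem_union_right _ (Finset.mem_biUnion.2 ⟨j, Finset.mem_univ _, ?_⟩)
    simp only [Finset.mem_union]
    exact Or.inl (Or.inr (hent _ _ _))
  have hFvh : ∀ j i i', (v j)ᴴ i i' ∈ F := fun j i i' => by
    refine Finset.mem_union_right _ (Finset.mem_biUnion.2 ⟨j, Finset.mem_univ _, ?_⟩)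
    simp only [Finset.mem_union]
    exact Or.inr (hent _ _ _)
  obtain ⟨B, hPB, α, β, γ, hα, hβ, hγ, horth, -, -, happ, hαmul, -, hβlim, hγc⟩ :=
    hA η hηpos F c hc hc0
  have hmul := fun x y => (hβlim x y).1
  -- transport to `B`
  have hVapp : ∀ j, l1 ((v j).map α * matRep (k j) ((b j).map α) * ((v j).map α)ᴴ -
      matRep (k j + 1) (a.map α)) ≤ 2 * ε1 := by
    intro j
    rw [← map_matRep, ← map_matRep, ← hα.map_conjTranspose]
    have h1 := l1_mul3_map_le hα (v j) (matRep (k j) (b j)) (v j)ᴴ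
    have h2 := l1_mul_map_le α (v j) (matRep (k j) (b j)) η
      (fun i i' l => (hαmul _ (hFv j i i') _ (hFr j i' l)).le)
    have h3 := l1_mul_map_le α (v j * matRep (k j) (b j)) (v j)ᴴ η
      (fun i i' l => (hαmul _ (hFvr j i i') _ (hFvh j i' l)).le)
    have h4 := l1_sub_le ((v j).map α * (matRep (k j) (b j)).map α * (v j)ᴴ.map α)
      ((v j * matRep (k j) (b j) * (v j)ᴴ).map α) ((matRep (k j + 1) a).map α)
    have h5 : l1 ((v j * matRep (k j) (b j) * (v j)ᴴ).map α - (matRep (k j + 1) a).map α) ≤ ε1 := by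
      rw [← matmap_sub]
      exact (hα.l1_map_le _).trans (hv j).le
    have h6 := mul_le_mul_of_nonneg_right h2 (l1_nonneg (v j)ᴴ)
    have h7 := hη3 j
    simp only [Fintype.card_prod, Fintype.card_fin] at h2 h3 h6
    linarith
  have hVδ : ∀ j, l1 ((v j).map α) * (k j * (mb j * (mb j * (2 * δ)))) * l1 ((v j).map α)
      ≤ 2 * ε1 := by
    intro j
    have h1 := hα.l1_map_le (v j)
    have h2 := l1_nonneg ((v j).map α)
    have h3 := l1_nonneg (v j)
    have : l1 ((v j).map α) * (k j * (mb j * (mb j * (2 * δ)))) * l1 ((v j).map α) ≤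
      l1 (v j) * (k j * (mb j * (mb j * (2 * δ)))) * l1 (v j) := by gcongr
    linarith [hδ j]
  obtain ⟨e, y, w, he, hy, hey, hw⟩ := comparison_step (hP B hPB) (hα.2 _ _ ha)
    (fun j => hα.2 _ _ (hb j)) k hk (fun j => (v j).map α) (show 0 < 2 * ε1 by positivity) hδpos
    hVapp hVδ
  -- choice of `θ`
  obtain ⟨θ, hθ, hθw⟩ : ∃ θ : ℝ, 0 < θ ∧ l1 w * ((N + 1) * θ) * l1 w < ε1 := by
    have hcont : Continuous fun θ : ℝ => l1 w * ((N + 1) * θ) * l1 w := by fun_prop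
    have := hcont.tendsto 0
    simp only [mul_zero, zero_mul] at this
    obtain ⟨θ, h1, h2⟩ := (((this.mono_left nhdsWithin_le_nhds).eventually
      (gt_mem_nhds hε1)).and (self_mem_nhdsWithin (s := Set.Ioi (0 : ℝ)))).exists
    exact ⟨θ, h2, h1⟩
  have hpb : ∀ᶠ n in atTop, ∀ j, ∃ R : Matrix (Fin (mb j)) (Fin (mb j)) A,
      l1 (R * b j * Rᴴ - (y j).map (β n)) ≤ θ := by
    refine Filter.eventually_all.2 fun j => ?_
    refine pullback_step hβ hγ horth hmul (hb j) (hα.2 _ _ (hb j)) (he j) (hy j) (hey j) ?_ hθ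
    intro n
    refine (l1_le_of_entry _ η fun i i' => ?_).trans (by simpa using hη1 j)
    have := happ _ (hFb j i i') n
    simpa using this.le
  have hlim := (tendsto_mul3_map hβ hmul w (Matrix.blockDiagonal' y) wᴴ).eventually
    (gt_mem_nhds hε1)
  obtain ⟨n, hR, hn⟩ := (hpb.and hlim).exists
  choose R hR using hR
  set Z := Matrix.blockDiagonal' fun j => R j * b j * (R j)ᴴ with hZ
  set W := w.map (β n) with hW
  refine ⟨W * Z * Wᴴ + a.map (γ n), ?_, ?_⟩
  · have hWl : l1 W ≤ l1 w := (hβ n).l1_map_le w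
    have hZy : l1 (Z - (Matrix.blockDiagonal' y).map (β n)) ≤ (N + 1) * θ := by
      have e1 : Z - (Matrix.blockDiagonal' y).map (β n) =
          Matrix.blockDiagonal' fun j => R j * b j * (R j)ᴴ - (y j).map (β n) := by
        have e2 : (Matrix.blockDiagonal' y).map (β n) =
            Matrix.blockDiagonal' fun j => (y j).map (β n) := by
          ext ⟨j, i⟩ ⟨j', i'⟩
          simp only [Matrix.map_apply, Matrix.blockDiagonal'_apply]
          split_ifs <;> simp
        rw [e2, hZ, ← Matrix.blockDiagonal'_sub]
        rfl
      rw [e1, l1_blockDiagonal']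
      refine (Finset.sum_le_sum fun j _ => hR j).trans ?_
      simp
    have s1 : l1 (W * Z * Wᴴ - W * (Matrix.blockDiagonal' y).map (β n) * Wᴴ) ≤ ε1 := by
      have e3 : W * Z * Wᴴ - W * (Matrix.blockDiagonal' y).map (β n) * Wᴴ =
          W * (Z - (Matrix.blockDiagonal' y).map (β n)) * Wᴴ := by
        rw [Matrix.mul_sub, Matrix.sub_mul]
      rw [e3]
      refine (l1_conj_le _ _).trans (le_trans ?_ hθw.le)
      have h2 := l1_nonneg W
      have h3 := l1_nonneg w
      have h4 := l1_nonneg (Z - (Matrix.blockDiagonal' y).map (β n))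
      gcongr
    have s2 : l1 (W * (Matrix.blockDiagonal' y).map (β n) * Wᴴ -
        (w * Matrix.blockDiagonal' y * wᴴ).map (β n)) < ε1 := by
      rw [hW, ← (hβ n).map_conjTranspose]
      exact hn
    have s3 : l1 ((w * Matrix.blockDiagonal' y * wᴴ).map (β n) - (a.map α).map (β n)) ≤
        na * (na * (4 * (2 * ε1))) + 2 * ε1 := by
      rw [← matmap_sub]
      exact ((hβ n).l1_map_le _).trans hw
    have s4 : l1 (a - a.map (γ n) - (a.map α).map (β n)) ≤ ε1 := by
      refine (l1_le_of_entry _ η fun i i' => ?_).trans (by simpa using hη2)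
      have := happ _ (hFa i i') n
      simpa using this.le
    have e5 : W * Z * Wᴴ + a.map (γ n) - a =
        (W * Z * Wᴴ - W * (Matrix.blockDiagonal' y).map (β n) * Wᴴ) +
        ((W * (Matrix.blockDiagonal' y).map (β n) * Wᴴ -
          (w * Matrix.blockDiagonal' y * wᴴ).map (β n)) +
        (((w * Matrix.blockDiagonal' y * wᴴ).map (β n) - (a.map α).map (β n)) +
        -(a - a.map (γ n) - (a.map α).map (β n)))) := by abel
    rw [e5]
    have t1 := l1_add_le (W * Z * Wᴴ - W * (Matrix.blockDiagonal' y).map (β n) * Wᴴ)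
        ((W * (Matrix.blockDiagonal' y).map (β n) * Wᴴ -
          (w * Matrix.blockDiagonal' y * wᴴ).map (β n)) +
        (((w * Matrix.blockDiagonal' y * wᴴ).map (β n) - (a.map α).map (β n)) +
        -(a - a.map (γ n) - (a.map α).map (β n))))
    have t2 := l1_add_le (W * (Matrix.blockDiagonal' y).map (β n) * Wᴴ -
          (w * Matrix.blockDiagonal' y * wᴴ).map (β n))
        (((w * Matrix.blockDiagonal' y * wᴴ).map (β n) - (a.map α).map (β n)) +
        -(a - a.map (γ n) - (a.map α).map (β n)))
    have t3 := l1_add_le ((w * Matrix.blockDiagonal' y * wᴴ).map (β n) - (a.map α).map (β n))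
        (-(a - a.map (γ n) - (a.map α).map (β n)))
    rw [l1_neg] at t3
    linarith
  · refine (cls_add_le _ _).trans (add_le_add ?_ ?_)
    · refine (cls_conj_le _ _).trans ?_
      rw [hZ, cls_blockDiagonal'_fin]
      exact Finset.sum_le_sum fun j _ => cls_conj_le _ _
    · refine (remainder_step ha (hγ n)).trans ?_
      exact nsmul_le_nsmul_right (hγc n).cls_sg na


/-! ### Consequences of simplicity -/

section Simple

variable {A : Type} [CStarAlgebra A]
variable {ι κ μ : Type} [Fintype ι] [Fintype κ] [Fintype μ]

theorem simple_prime (hs : IsSimpleCStarAlgebra A) {x y : A} (hx : x ≠ 0) (hy : y ≠ 0) :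
    ∃ z, x * z * y ≠ 0 := by
  by_contra! hcon
  let I : TwoSidedIdeal A := TwoSidedIdeal.mk' {t : A | ∀ z, x * z * t = 0}
    (by intro z; simp) (by intro s t hs ht z; rw [mul_add, hs z, ht z, add_zero])
    (by intro t ht z; rw [mul_neg, ht z, neg_zero])
    (by intro s t ht z; rw [← mul_assoc, mul_assoc x z s]; exact ht _)
    (by intro s t hs z; rw [← mul_assoc, hs z, zero_mul])
  have hI : ∀ t, t ∈ I ↔ ∀ z, x * z * t = 0 := fun t => TwoSidedIdeal.mem_mk' _ _ _ _ _ _ _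
  have hcl : IsClosed (I : Set A) := by
    have : (I : Set A) = ⋂ z, {t : A | x * z * t = 0} := by
      ext t
      simp only [Set.mem_iInter, Set.mem_setOf_eq]
      exact hI t
    rw [this]
    exact isClosed_iInter fun z => isClosed_eq (by fun_prop) (by fun_prop)
  rcases hs I hcl with h | h
  · have : y ∈ I := (hI y).2 hcon
    rw [h] at this
    exact hy (by simpa using this)
  · have : (1 : A) ∈ I := by rw [h]; trivial
    have := (hI 1).1 this 1
    exact hx (by simpa using this)

theorem cls_le_of_forall_delta {y : Matrix ι ι A} (hy : MatPos y) {T : CW A} [DecidableEq ι]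
    (h : ∀ δ : ℝ, 0 < δ → ∃ z : Matrix ι ι A, MatPos z ∧
      MatPos (z + (δ : ℂ) • (1 : Matrix ι ι A) - y) ∧ cls z ≤ T) : cls y ≤ T := by
  refine cls_le_of_approx fun ε hε => ?_
  set C : ℝ := Fintype.card ι * (Fintype.card ι * 2) + 1 with hC
  have hCpos : 0 < C := by positivity
  have hδ : 0 < ε / C := by positivity
  obtain ⟨z, hz, hzy, hzT⟩ := h _ hδ
  obtain ⟨R, hR⟩ := mat_le hy hz hδ hzy
  refine ⟨R * z * Rᴴ, hR.trans_lt ?_, (cls_conj_le _ _).trans hzT⟩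
  have : (Fintype.card ι : ℝ) * (Fintype.card ι * (2 * (ε / C))) = (C - 1) * (ε / C) := by
    rw [hC]; ring
  rw [this]
  have : C * (ε / C) = ε := by field_simp
  nlinarith

theorem cls_le_sq {y : Matrix ι ι A} (hy : MatPos y) : cls y ≤ cls (y * y) := by
  classical
  refine cls_le_of_forall_delta hy fun δ hδ => ?_
  set s := √δ with hs
  have hspos : 0 < s := Real.sqrt_pos.2 hδ
  have hss : s * s = δ := Real.mul_self_sqrt hδ.le
  set u : ℝ := (2 * s)⁻¹ with hu
  have hus : u * s = 1 / 2 := by rw [hu]; field_simp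
  have hys := hy.conjTranspose_eq
  refine ⟨((u * u : ℝ) : ℂ) • (y * y), ?_, ?_, cls_smul_le _ (by positivity) _⟩
  · refine ⟨(u : ℂ) • y, ?_⟩
    rw [Matrix.conjTranspose_smul, hys, Complex.star_def, Complex.conj_ofReal, Matrix.smul_mul,
      Matrix.mul_smul, smul_smul, Complex.ofReal_mul]
  · refine ⟨(u : ℂ) • y - (s : ℂ) • 1, ?_⟩
    have hus' : (u : ℂ) * s = 1 / 2 := by
      rw [← Complex.ofReal_mul, hus]; norm_num
    have hss' : (s : ℂ) * s = δ := by exact_mod_cast congrArg (fun t : ℝ => (t : ℂ)) hss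
    have e1 : ((u : ℂ) • y - (s : ℂ) • (1 : Matrix ι ι A))ᴴ = (u : ℂ) • y - (s : ℂ) • 1 := by
      simp [Matrix.conjTranspose_smul, hys]
    rw [e1]
    simp only [Matrix.mul_sub, Matrix.sub_mul, Matrix.smul_mul, Matrix.mul_smul, Matrix.mul_one,
      Matrix.one_mul, smul_sub, smul_smul, hus', mul_comm (s : ℂ) u, hss', Complex.ofReal_mul]
    generalize y * y = Y2
    module

theorem cls_mul_star_le (Y : Matrix ι κ A) : cls (Y * Yᴴ) ≤ cls (Yᴴ * Y) := by
  have h : MatPos (Y * Yᴴ) := by simpa using matPos_rect Yᴴ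
  refine (cls_le_sq h).trans ?_
  have : Y * Yᴴ * (Y * Yᴴ) = Y * (Yᴴ * Y) * Yᴴ := by simp only [Matrix.mul_assoc]
  rw [this]
  exact cls_conj_le _ _

theorem sg_mul (x y : A) : sg (x * y) = sg x * sg y := by
  ext; simp [sg, Matrix.mul_apply]

theorem sg_star (x : A) : sg (star x) = (sg x)ᴴ := by
  ext; simp [sg]

theorem cls_sg_conj_le (w x : A) : cls (sg (w * x * star w)) ≤ cls (sg x) := by
  rw [sg_mul, sg_mul, sg_star]
  exact cls_conj_le _ _

theorem cls_sg_mul_star (y : A) : cls (sg (y * star y)) ≤ cls (sg (star y * y)) := by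
  rw [sg_mul, sg_mul, sg_star]
  exact cls_mul_star_le _

/-- Positive elements as squares. -/
def Pos1 (x : A) : Prop := ∃ d : A, x = star d * d

theorem Pos1.conj {x : A} (h : Pos1 x) (w : A) : Pos1 (w * x * star w) := by
  obtain ⟨d, rfl⟩ := h
  exact ⟨d * star w, by simp [mul_assoc]⟩

theorem small_one (hs : IsSimpleCStarAlgebra A) {x t : A} (hx : Pos1 x) (hx0 : x ≠ 0)
    (ht : Pos1 t) (ht0 : t ≠ 0) :
    ∃ w, w * x * star w ≠ 0 ∧ cls (sg (w * x * star w)) ≤ cls (sg t) := by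
  obtain ⟨d, rfl⟩ := hx
  obtain ⟨g, rfl⟩ := ht
  have hd : star d ≠ 0 := by rintro h; apply hx0; rw [h, zero_mul]
  obtain ⟨z, hz⟩ := simple_prime hs ht0 hd
  set Y := star g * g * z * star d with hY
  have e : star g * g * z * (star d * d) * star (star g * g * z) = Y * star Y := by
    simp [hY, mul_assoc]
  refine ⟨star g * g * z, ?_, ?_⟩
  · rw [e]
    exact fun h => hz (CStarRing.mul_star_self_eq_zero_iff _ |>.1 h)
  · rw [e]
    refine (cls_sg_mul_star _).trans ?_
    have e2 : star Y * Y = star (z * star d) * (star g * (g * star g) * star (star g)) *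
        star (star (z * star d)) := by
      simp [hY, mul_assoc]
    rw [e2]
    exact ((cls_sg_conj_le _ _).trans (cls_sg_conj_le _ _)).trans (cls_sg_mul_star g)

theorem small_family (hs : IsSimpleCStarAlgebra A) {x : A} (hx : Pos1 x) (hx0 : x ≠ 0) (n : ℕ)
    (t : Fin n → A) (ht : ∀ i, Pos1 (t i)) (ht0 : ∀ i, t i ≠ 0) :
    ∃ w, w * x * star w ≠ 0 ∧ ∀ i, cls (sg (w * x * star w)) ≤ cls (sg (t i)) := by
  induction n with
  | zero => exact ⟨1, by simpa using hx0, fun i => i.elim0⟩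
  | succ n ih =>
    obtain ⟨w, hw, hwt⟩ := ih (fun i => t i.castSucc) (fun i => ht _) (fun i => ht0 _)
    obtain ⟨w', hw', hwt'⟩ := small_one hs (hx.conj w) hw (ht (Fin.last n)) (ht0 _)
    have e : w' * w * x * star (w' * w) = w' * (w * x * star w) * star w' := by simp [mul_assoc]
    refine ⟨w' * w, by rwa [e], fun i => ?_⟩
    rw [e]
    refine Fin.lastCases ?_ (fun i => ?_) i
    · exact hwt'
    · exact (cls_sg_conj_le _ _).trans (hwt i)

/-- Existence of `N` mutually orthogonal pieces below `c`. -/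
def Orth (N : ℕ) (c : A) : Prop :=
  ∃ s : Fin N → A, (∀ i j, i ≠ j → s i * c * star (s j) = 0) ∧ ∀ i, s i * c * star (s i) ≠ 0

theorem orth_sum {n : ℕ} {b : Matrix ι ι A} (S : Fin n → Matrix Unit ι A)
    (h : ∀ i j, i ≠ j → S i * b * (S j)ᴴ = 0) : ∑ i, cls (S i * b * (S i)ᴴ) ≤ cls b := by
  rw [← cls_blockDiagonal]
  let v : Matrix (Unit × Fin n) ι A := Matrix.of fun p l => S p.2 p.1 l
  have e : Matrix.blockDiagonal (fun i => S i * b * (S i)ᴴ) = v * b * vᴴ := by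
    ext ⟨u, i⟩ ⟨u', j⟩
    have e1 : (v * b * vᴴ) (u, i) (u', j) = (S i * b * (S j)ᴴ) u u' := by
      simp [v, Matrix.mul_apply]
    rw [e1, Matrix.blockDiagonal_apply]
    split_ifs with hij
    · simp only at hij; rw [hij]
    · simp only at hij; rw [h i j hij]; rfl
  rw [e]
  exact cls_conj_le _ _

theorem exists_small_mult (hs : IsSimpleCStarAlgebra A) {d : A} (hd : Pos1 d) (hd0 : d ≠ 0) (n : ℕ)
    (ho : Orth n d) : ∃ c, Pos1 c ∧ c ≠ 0 ∧ n • cls (sg c) ≤ cls (sg d) := by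
  obtain ⟨s, hs1, hs2⟩ := ho
  obtain ⟨w, hw, hwt⟩ := small_family hs hd hd0 n (fun i => s i * d * star (s i))
    (fun i => hd.conj _) hs2
  refine ⟨_, hd.conj w, hw, ?_⟩
  have h1 := orth_sum (b := sg d) (fun i => sg (s i)) (fun i j hij => by
    rw [← sg_star, ← sg_mul, ← sg_mul, hs1 i j hij]; ext; simp [sg])
  refine le_trans ?_ h1
  have h2 : n • cls (sg (w * d * star w)) = ∑ _i : Fin n, cls (sg (w * d * star w)) := by simp
  rw [h2]
  refine Finset.sum_le_sum fun i _ => ?_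
  rw [← sg_star, ← sg_mul, ← sg_mul]
  exact hwt i

theorem pos1_iff [PartialOrder A] [StarOrderedRing A] {x : A} : Pos1 x ↔ 0 ≤ x :=
  (gen_nonneg_iff x).symm

theorem fc_split {p : A} (hp : Pos1 p) (hp0 : p ≠ 0) :
    ∃ l q r : A, star l = l ∧ star q = q ∧ star r = r ∧ q * p * l = q ∧ q * p * q ≠ 0 ∧
      r * r = l + l - l * p * l := by
  let _ := CStarAlgebra.spectralOrder A
  have _ := CStarAlgebra.spectralOrderedRing A
  rw [pos1_iff] at hp
  have hsa : IsSelfAdjoint p := IsSelfAdjoint.of_nonneg hp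
  have hn : 0 < ‖p‖ := norm_pos_iff.2 hp0
  set ρ := ‖p‖ / 2 with hρ
  have hρp : 0 < ρ := by positivity
  have hden : ∀ t : ℝ, 0 < max t ρ := fun t => lt_max_of_lt_right hρp
  have hl : Continuous fun t : ℝ => 1 / max t ρ :=
    Continuous.div (by fun_prop) (by fun_prop) fun t => (hden t).ne'
  have hq : Continuous fun t : ℝ => max (t - ρ) 0 := by fun_prop
  have hk : Continuous fun t : ℝ => 1 / max t ρ + 1 / max t ρ - 1 / max t ρ * t * (1 / max t ρ) := by
    fun_prop
  have hr := hk.sqrt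
  have hid : Continuous fun t : ℝ => t := continuous_id
  refine ⟨cfc (fun t : ℝ => 1 / max t ρ) p, cfc (fun t : ℝ => max (t - ρ) 0) p,
    cfc (fun t : ℝ => √(1 / max t ρ + 1 / max t ρ - 1 / max t ρ * t * (1 / max t ρ))) p,
    (IsSelfAdjoint.star_eq (cfc_predicate (R := ℝ) _ p)), (IsSelfAdjoint.star_eq (cfc_predicate (R := ℝ) _ p)), (IsSelfAdjoint.star_eq (cfc_predicate (R := ℝ) _ p)), ?_, ?_, ?_⟩
  · have e : cfc (fun t : ℝ => max (t - ρ) 0) p * p * cfc (fun t : ℝ => 1 / max t ρ) p =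
        cfc (fun t : ℝ => max (t - ρ) 0 * t * (1 / max t ρ)) p := by
      rw [cfc_mul (fun t : ℝ => max (t - ρ) 0 * t) _ p (hq.mul hid).continuousOn hl.continuousOn,
        cfc_mul _ (fun t : ℝ => t) p hq.continuousOn hid.continuousOn, cfc_id' ℝ p]
    rw [e]
    congr 1
    ext t
    rcases le_total t ρ with h | h
    · rw [max_eq_right (by linarith : t - ρ ≤ 0)]; simp
    · rw [max_eq_left h]
      have : t ≠ 0 := by linarith
      field_simp
  · have e : cfc (fun t : ℝ => max (t - ρ) 0) p * p * cfc (fun t : ℝ => max (t - ρ) 0) p =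
        cfc (fun t : ℝ => max (t - ρ) 0 * t * max (t - ρ) 0) p := by
      rw [cfc_mul (fun t : ℝ => max (t - ρ) 0 * t) _ p (hq.mul hid).continuousOn hq.continuousOn,
        cfc_mul _ (fun t : ℝ => t) p hq.continuousOn hid.continuousOn, cfc_id' ℝ p]
    rw [e]
    intro h0
    have hmem : ‖p‖ ∈ spectrum ℝ p := by
      have : Nontrivial A := ⟨⟨p, 0, hp0⟩⟩
      exact CStarAlgebra.norm_mem_spectrum_of_nonneg
    have h1 := (norm_apply_le_norm_cfc (fun t : ℝ => max (t - ρ) 0 * t * max (t - ρ) 0) p hmem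
      ((hq.mul hid).mul hq).continuousOn)
    rw [h0, norm_zero] at h1
    have h2 : max (‖p‖ - ρ) 0 = ρ := by
      rw [max_eq_left] <;> rw [hρ] <;> linarith
    rw [h2, Real.norm_eq_abs] at h1
    have : 0 < ρ * ‖p‖ * ρ := by positivity
    rw [abs_of_pos this] at h1
    linarith
  · rw [← cfc_mul _ _ p hr.continuousOn hr.continuousOn]
    have e : cfc (fun t : ℝ => 1 / max t ρ) p + cfc (fun t : ℝ => 1 / max t ρ) p -
        cfc (fun t : ℝ => 1 / max t ρ) p * p * cfc (fun t : ℝ => 1 / max t ρ) p =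
        cfc (fun t : ℝ => 1 / max t ρ + 1 / max t ρ - 1 / max t ρ * t * (1 / max t ρ)) p := by
      rw [cfc_sub (fun t : ℝ => 1 / max t ρ + 1 / max t ρ)
        (fun t : ℝ => 1 / max t ρ * t * (1 / max t ρ)) p (hl.add hl).continuousOn
        ((hl.mul hid).mul hl).continuousOn,
        cfc_add p (fun t : ℝ => 1 / max t ρ) (fun t : ℝ => 1 / max t ρ) hl.continuousOn hl.continuousOn,
        cfc_mul (fun t : ℝ => 1 / max t ρ * t) _ p (hl.mul hid).continuousOn hl.continuousOn,
        cfc_mul _ (fun t : ℝ => t) p hl.continuousOn hid.continuousOn, cfc_id' ℝ p]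
    rw [e]
    refine cfc_congr fun t ht => ?_
    have ht0 : 0 ≤ t := spectrum_nonneg_of_nonneg hp ht
    refine Real.mul_self_sqrt ?_
    have h1 := hden t
    have h2 : t ≤ max t ρ := le_max_left _ _
    have : 1 / max t ρ * t ≤ 1 := by
      rw [one_div, inv_mul_le_iff₀ h1]; linarith
    have h3 : 0 < 1 / max t ρ := by positivity
    nlinarith

theorem exists_diag_ne_zero {m : ℕ} {b : Matrix (Fin m) (Fin m) A} (hb : MatPos b) (hb0 : b ≠ 0) :
    ∃ i, b i i ≠ 0 := by
  let _ := CStarAlgebra.spectralOrder A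
  have _ := CStarAlgebra.spectralOrderedRing A
  by_contra! hcon
  obtain ⟨c, rfl⟩ := hb
  apply hb0
  have : c = 0 := by
    ext k i
    have h1 := hcon i
    simp only [Matrix.mul_apply, Matrix.conjTranspose_apply] at h1
    rw [Finset.sum_eq_zero_iff_of_nonneg fun k _ => star_mul_self_nonneg _] at h1
    exact (CStarRing.star_mul_self_eq_zero_iff _).1 (h1 k (Finset.mem_univ _))
  simp [this]

theorem split_step (hs : IsSimpleCStarAlgebra A) {m : ℕ} {b : Matrix (Fin m) (Fin m) A}
    (hb : MatPos b) (hb0 : b ≠ 0) (M : ℕ) (ho : ∀ c : A, Pos1 c → c ≠ 0 → Orth (M + 1) c) :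
    ∃ (b' : Matrix (Fin m) (Fin m) A) (d : A) (h : CW A), MatPos b' ∧ Pos1 d ∧ d ≠ 0 ∧
      cls b' + cls (sg d) ≤ cls b ∧ cls b ≤ cls b' + h ∧ M • h ≤ cls b' := by
  obtain ⟨i0, hi0⟩ := exists_diag_ne_zero hb hb0
  have hbs := hb.conjTranspose_eq
  have hpos : Pos1 (b i0 i0) := by
    let _ := CStarAlgebra.spectralOrder A
    have _ := CStarAlgebra.spectralOrderedRing A
    rw [pos1_iff]
    obtain ⟨c, rfl⟩ := hb
    simp only [Matrix.mul_apply, Matrix.conjTranspose_apply]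
    exact Finset.sum_nonneg fun k _ => star_mul_self_nonneg _
  obtain ⟨s', hs1, hs2⟩ := ho _ hpos hi0
  let S : Fin (M + 1) → Matrix Unit (Fin m) A := fun i => Matrix.of fun _ l =>
    if l = i0 then s' i else 0
  have hS : ∀ i j, S i * b * (S j)ᴴ = sg (s' i * b i0 i0 * star (s' j)) := by
    intro i j
    ext
    simp [S, sg, Matrix.mul_apply, apply_ite star]
  have hSo : ∀ i j, i ≠ j → S i * b * (S j)ᴴ = 0 := by
    intro i j hij
    rw [hS, hs1 i j hij]; ext; simp [sg]
  obtain ⟨w, hw, hwt⟩ := small_family hs (hpos.conj (s' 0)) (hs2 0) M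
    (fun i => s' i.succ * b i0 i0 * star (s' i.succ)) (fun i => hpos.conj _) (fun i => hs2 _)
  set p := w * (s' 0 * b i0 i0 * star (s' 0)) * star w with hp
  have hpp : Pos1 p := (hpos.conj _).conj _
  set s := sg w * S 0 with hsdef
  have hsb : s * b * sᴴ = sg p := by
    rw [hp, sg_mul, sg_mul, sg_star, ← hS, hsdef, Matrix.conjTranspose_mul]
    simp only [Matrix.mul_assoc]
  have hSs : ∀ i, i ≠ 0 → S i * b * sᴴ = 0 := by
    intro i hi
    rw [hsdef, Matrix.conjTranspose_mul, ← Matrix.mul_assoc, hSo i 0 hi, Matrix.zero_mul]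
  have hsS : ∀ i, i ≠ 0 → s * b * (S i)ᴴ = 0 := by
    intro i hi
    rw [hsdef, Matrix.mul_assoc, Matrix.mul_assoc, ← Matrix.mul_assoc (S 0), hSo 0 i hi.symm,
      Matrix.mul_zero]
  obtain ⟨l, q, r, hl, hq, hr, hqpl, hqpq, hrr⟩ := fc_split hpp hw
  have hl' : (sg l)ᴴ = sg l := by rw [← sg_star, hl]
  have hq' : (sg q)ᴴ = sg q := by rw [← sg_star, hq]
  have hr' : (sg r)ᴴ = sg r := by rw [← sg_star, hr]
  have hqpl' : sg q * sg p * sg l = sg q := by rw [← sg_mul, ← sg_mul, hqpl]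
  have hrr' : sg r * sg r = sg l + sg l - sg l * sg p * sg l := by
    rw [← sg_mul, hrr]
    ext; simp [sg, Matrix.mul_apply]
  set v1 := sg q * s with hv1
  set v2 := 1 - b * sᴴ * sg l * s with hv2
  have hv2h : v2ᴴ = 1 - sᴴ * sg l * s * b := by
    simp only [hv2, Matrix.conjTranspose_sub, Matrix.conjTranspose_mul, hbs, hl',
      Matrix.conjTranspose_conjTranspose, Matrix.conjTranspose_one, Matrix.mul_assoc]
  set h0 := b * sᴴ * (sg r * sg r) * s * b with hh0
  have hb' : v2 * b * v2ᴴ = b - h0 := by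
    have e1 : b * sᴴ * sg l * s * b * (sᴴ * sg l * s * b) =
        b * sᴴ * (sg l * sg p * sg l) * s * b := by
      rw [← hsb]; simp only [Matrix.mul_assoc]
    rw [hv2h, hv2, hh0, hrr', Matrix.sub_mul, Matrix.sub_mul, Matrix.one_mul, Matrix.mul_sub,
      Matrix.mul_sub, e1]
    simp only [Matrix.mul_sub, Matrix.sub_mul, Matrix.mul_add, Matrix.add_mul, Matrix.mul_one,
      Matrix.mul_assoc]
    abel
  have h12 : v1 * b * v2ᴴ = 0 := by
    have e1 : sg q * s * b * (sᴴ * sg l * s * b) = (sg q * sg p * sg l) * s * b := by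
      rw [← hsb]; simp only [Matrix.mul_assoc]
    rw [hv2h, hv1, Matrix.mul_sub, e1, hqpl', Matrix.mul_one, sub_self]
  have h21 : v2 * b * v1ᴴ = 0 := by
    have := congrArg Matrix.conjTranspose h12
    simpa [Matrix.conjTranspose_mul, hbs, Matrix.mul_assoc] using this
  have h11 : v1 * b * v1ᴴ = sg (q * p * q) := by
    rw [hv1, Matrix.conjTranspose_mul, hq', sg_mul, sg_mul, ← hsb]
    simp only [Matrix.mul_assoc]
  refine ⟨v2 * b * v2ᴴ, q * p * q, cls h0, hb.conj _, ?_, hqpq, ?_, ?_, ?_⟩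
  · have := hpp.conj q
    rwa [hq] at this
  · rw [← h11, ← cls_fromBlocks]
    have e : Matrix.fromBlocks (v2 * b * v2ᴴ) 0 0 (v1 * b * v1ᴴ) =
        Matrix.fromRows v2 v1 * b * (Matrix.fromRows v2 v1)ᴴ := by
      rw [Matrix.conjTranspose_fromRows_eq_fromCols_conjTranspose, Matrix.fromRows_mul,
        Matrix.fromRows_mul_fromCols, h12, h21]
    rw [e]
    exact cls_conj_le _ _
  · have := cls_add_le (v2 * b * v2ᴴ) h0
    rw [hb', sub_add_cancel] at this
    rwa [hb']
  · have hh0p : ∀ i : Fin M, cls h0 ≤ cls (S i.succ * b * (S i.succ)ᴴ) := by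
      intro i
      rw [hS]
      refine le_trans ?_ (hwt i)
      obtain ⟨c, hc⟩ := hb
      have e1 : h0 = cᴴ * ((c * sᴴ * sg r) * (c * sᴴ * sg r)ᴴ) * cᴴᴴ := by
        simp only [hh0, Matrix.conjTranspose_mul, hr', Matrix.conjTranspose_conjTranspose]
        rw [hc]
        simp only [Matrix.mul_assoc]
      rw [e1]
      refine (cls_conj_le _ _).trans ((cls_mul_star_le _).trans ?_)
      have e2 : (c * sᴴ * sg r)ᴴ * (c * sᴴ * sg r) = sg r * sg p * (sg r)ᴴ := by
        rw [← hsb, hc]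
        simp only [Matrix.conjTranspose_mul, hr', Matrix.conjTranspose_conjTranspose,
          Matrix.mul_assoc]
      rw [e2]
      exact cls_conj_le _ _
    have hSb' : ∀ i j, i ≠ 0 → S i * (v2 * b * v2ᴴ) * (S j)ᴴ = S i * b * (S j)ᴴ := by
      intro i j hi
      have e1 : S i * h0 * (S j)ᴴ = (S i * b * sᴴ) * ((sg r * sg r) * s * b * (S j)ᴴ) := by
        rw [hh0]; simp only [Matrix.mul_assoc]
      rw [hb', Matrix.mul_sub, Matrix.sub_mul, e1, hSs i hi, Matrix.zero_mul, sub_zero]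
    have h1 := orth_sum (b := v2 * b * v2ᴴ) (fun i : Fin M => S i.succ) (fun i j hij => by
      rw [hSb' _ _ (Fin.succ_ne_zero i)]
      exact hSo _ _ fun h => hij (Fin.succ_injective _ h))
    refine le_trans ?_ h1
    have h2 : M • cls h0 = ∑ _i : Fin M, cls h0 := by simp
    rw [h2]
    refine Finset.sum_le_sum fun i _ => ?_
    rw [hSb' _ _ (Fin.succ_ne_zero i)]
    exact hh0p i

/-- The non-elementary case. -/
theorem nonelementary_case (P : BundledCStarAlgebra → Prop) (N : ℕ)
    (hP : ∀ B : BundledCStarAlgebra, P B → NComparison B.carrier N)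
    (hs : IsSimpleCStarAlgebra A) (hA : AsympTraciallyIn P A)
    (ho : ∀ (n : ℕ) (c : A), Pos1 c → c ≠ 0 → Orth n c) : NComparison A N := by
  classical
  intro na mb a b ha hb hab
  rw [← cls_le_cls, cls_blockDiagonal'_fin]
  have hab0 := hab 0
  obtain ⟨k, hk, hkab⟩ := hab 0
  rw [← cls_le_cls, cls_matRep, cls_matRep] at hkab
  by_cases hb0 : b 0 = 0
  · rw [hb0, cls_zero, smul_zero] at hkab
    have h1 : cls a ≤ 0 := by
      refine le_trans ?_ hkab
      rw [succ_nsmul']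
      exact le_add_of_nonneg_right (nsmul_nonneg (CW.zero_le _) _)
    exact h1.trans (Finset.sum_nonneg fun j _ => CW.zero_le _)
  obtain ⟨b', d, h, hb', hd, hd0, h1, h2, h3⟩ := split_step hs (hb 0) hb0 (2 * k)
    fun c hc hc0 => ho _ c hc hc0
  obtain ⟨c, hc, hc0, hcd⟩ := exists_small_mult hs hd hd0 na (ho _ d hd hd0)
  let b2 : ∀ j, Matrix (Fin (mb j)) (Fin (mb j)) A := Function.update b 0 b'
  have hb20 : b2 0 = b' := Function.update_self _ _ _
  have hb2j : ∀ j, j ≠ 0 → b2 j = b j := fun j hj => Function.update_of_ne hj _ _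
  have hm := main_claim P N hP A hA (b := b2) ha (fun j => ?_) (fun j => ?_) hc hc0
  · refine hm.trans ?_
    rw [← Finset.add_sum_erase _ _ (Finset.mem_univ (0 : Fin (N + 1))),
      ← Finset.add_sum_erase _ _ (Finset.mem_univ (0 : Fin (N + 1))), hb20, add_right_comm]
    refine add_le_add ((add_le_add le_rfl hcd).trans h1) (Finset.sum_le_sum fun j hj => ?_)
    rw [hb2j j (Finset.ne_of_mem_erase hj)]
  · rcases eq_or_ne j 0 with rfl | hj
    · rwa [hb20]
    · rw [hb2j j hj]; exact hb j
  · rcases eq_or_ne j 0 with rfl | hj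
    · refine ⟨2 * k + 1, by omega, ?_⟩
      rw [hb20, ← cls_le_cls, cls_matRep, cls_matRep]
      calc (2 * k + 1 + 1) • cls a = 2 • ((k + 1) • cls a) := by rw [smul_smul]; congr 1
        _ ≤ 2 • (k • cls (b 0)) := nsmul_le_nsmul_right hkab 2
        _ = (2 * k) • cls (b 0) := by rw [smul_smul]
        _ ≤ (2 * k) • (cls b' + h) := nsmul_le_nsmul_right h2 _
        _ = (2 * k) • cls b' + (2 * k) • h := nsmul_add _ _ _
        _ ≤ (2 * k) • cls b' + cls b' := by gcongr
        _ = (2 * k + 1) • cls b' := (succ_nsmul _ _).symm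
    · rw [hb2j j hj]; exact hab j

end Simple


/-! ### The elementary case -/

section Elementary

variable {A : Type} [CStarAlgebra A]
variable {ι κ μ : Type} [Fintype ι] [Fintype κ] [Fintype μ]

theorem exists_not_orth_two (h : ∃ (n : ℕ) (c : A), Pos1 c ∧ c ≠ 0 ∧ ¬ Orth n c) :
    ∃ t : A, Pos1 t ∧ t ≠ 0 ∧ ¬ Orth 2 t := by
  classical
  obtain ⟨n, c, hc, hc0, hn⟩ := h
  by_contra! hcon
  apply hn
  clear hn
  have key : ∀ n, Orth (n + 1) c := by
    intro n
    induction n with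
    | zero =>
      refine ⟨fun _ => 1, fun i j hij => absurd (by omega : i = j) hij, fun i => by simpa using hc0⟩
    | succ n ih =>
      obtain ⟨s, hs1, hs2⟩ := ih
      obtain ⟨u, hu1, hu2⟩ := hcon _ (hc.conj (s 0)) (hs2 0)
      have e : ∀ a b x y : A, a * x * c * star (b * y) = a * (x * c * star y) * star b := by
        intro a b x y; simp [mul_assoc]
      have e1 : ∀ a x y : A, a * x * c * star y = a * (x * c * star y) := by
        intro a x y; simp [mul_assoc]
      have e2 : ∀ b x y : A, x * c * star (b * y) = (x * c * star y) * star b := by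
        intro a x y; simp [mul_assoc]
      refine ⟨Fin.cons (u 0 * s 0) (Fin.cons (u 1 * s 0) fun i => s i.succ), ?_, ?_⟩
      · intro i j
        refine Fin.cases ?_ (fun i => Fin.cases ?_ (fun i => ?_) i) i <;>
        refine Fin.cases ?_ (fun j => Fin.cases ?_ (fun j => ?_) j) j <;>
        simp only [Fin.cons_zero, Fin.cons_succ] <;> intro hij
        · exact absurd rfl hij
        · rw [e]; exact hu1 0 1 (by decide)
        · rw [e1, hs1 _ _ (Fin.succ_ne_zero j).symm, mul_zero]
        · rw [e]; exact hu1 1 0 (by decide)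
        · exact absurd rfl hij
        · rw [e1, hs1 _ _ (Fin.succ_ne_zero j).symm, mul_zero]
        · rw [e2, hs1 _ _ (Fin.succ_ne_zero i), zero_mul]
        · rw [e2, hs1 _ _ (Fin.succ_ne_zero i), zero_mul]
        · exact hs1 _ _ fun h => hij (congrArg _ h)
      · intro i
        refine Fin.cases ?_ (fun i => Fin.cases ?_ (fun i => ?_) i) i <;>
        simp only [Fin.cons_zero, Fin.cons_succ]
        · rw [e]; exact hu2 0
        · rw [e]; exact hu2 1
        · exact hs2 _
  cases n with
  | zero => exact ⟨fun _ => 1, fun i => i.elim0, fun i => i.elim0⟩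
  | succ n => exact key n

theorem norm_mul_of_not_orth {t h : A} (ht : Pos1 t) (hno : ¬ Orth 2 t) (hh : Pos1 h)
    (hcomm : Commute h t)
    (hne : ∀ r : ℝ, 0 < r → r < ‖h‖ →
      cfc (fun x : ℝ => max (x - r) 0) h * t * cfc (fun x : ℝ => max (x - r) 0) h ≠ 0) :
    h * t = (‖h‖ : ℂ) • t := by
  let _ := CStarAlgebra.spectralOrder A
  have _ := CStarAlgebra.spectralOrderedRing A
  rw [pos1_iff] at hh
  have hsa : IsSelfAdjoint h := IsSelfAdjoint.of_nonneg hh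
  rcases eq_or_ne h 0 with rfl | h0
  · simp
  have hn : 0 < ‖h‖ := norm_pos_iff.2 h0
  have key : ∀ r : ℝ, 0 < r → r < ‖h‖ → ‖h * t - (‖h‖ : ℂ) • t‖ ≤ (‖h‖ - r) * ‖t‖ := by
    intro r hr0 hr
    have hf : Continuous fun x : ℝ => max (x - r) 0 := by fun_prop
    have hg : Continuous fun x : ℝ => max (r - x) 0 := by fun_prop
    have hid : Continuous fun t : ℝ => t := continuous_id
    set f := cfc (fun x : ℝ => max (x - r) 0) h with hfd
    set g := cfc (fun x : ℝ => max (r - x) 0) h with hgd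
    have hfs : star f = f := IsSelfAdjoint.star_eq (cfc_predicate (R := ℝ) _ h)
    have hgs : star g = g := IsSelfAdjoint.star_eq (cfc_predicate (R := ℝ) _ h)
    have hgt : Commute g t := hcomm.cfc_real _
    have hft : Commute f t := hcomm.cfc_real _
    have hfg : f * g = 0 := by
      rw [hfd, hgd, ← cfc_mul _ _ h hf.continuousOn hg.continuousOn]
      have : (fun x : ℝ => max (x - r) 0 * max (r - x) 0) = fun _ => 0 := by
        ext x
        rcases le_total x r with h | h
        · rw [max_eq_right (by linarith : x - r ≤ 0), zero_mul]
        · rw [max_eq_right (by linarith : r - x ≤ 0), mul_zero]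
      rw [this]; simp
    have hgf : g * f = 0 := by
      have := congrArg star hfg
      simpa [hfs, hgs] using this
    have hgtg : g * t * g = 0 := by
      by_contra hne2
      apply hno
      refine ⟨![f, g], ?_, ?_⟩
      · intro i j hij
        fin_cases i <;> fin_cases j <;> simp [hfs, hgs] at hij ⊢
        · rw [mul_assoc, ← hgt.eq, ← mul_assoc, hfg, zero_mul]
        · rw [mul_assoc, ← hft.eq, ← mul_assoc, hgf, zero_mul]
      · intro i
        fin_cases i <;> simp only [Fin.zero_eta, Fin.mk_one, Matrix.cons_val_zero, Matrix.cons_val_one, hfs, hgs]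
        · exact hne r hr0 hr
        · exact hne2
    have hgt0 : g * t = 0 := by
      obtain ⟨d, rfl⟩ := ht
      have : star (d * g) * (d * g) = 0 := by
        rw [star_mul, hgs, ← hgtg]; simp [mul_assoc]
      have hdg := (CStarRing.star_mul_self_eq_zero_iff _).1 this
      rw [hgt.eq, mul_assoc, hdg, mul_zero]
    have e1 : h * t - (‖h‖ : ℂ) • t = (h - (algebraMap ℝ A ‖h‖) + g) * t := by
      rw [add_mul, hgt0, add_zero, sub_mul, gen_algebraMap, smul_mul_assoc, one_mul]
    have e2 : h - (algebraMap ℝ A ‖h‖) + g = cfc (fun x : ℝ => x - ‖h‖ + max (r - x) 0) h := by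
      rw [cfc_add h (fun x : ℝ => x - ‖h‖) (fun x => max (r - x) 0) (by fun_prop) hg.continuousOn,
        cfc_sub (fun x : ℝ => x) (fun _ => ‖h‖) h (by fun_prop) (by fun_prop), cfc_id' ℝ h,
        cfc_const _ h]
    rw [e1, e2]
    refine (norm_mul_le _ _).trans (mul_le_mul_of_nonneg_right ?_ (norm_nonneg _))
    refine norm_cfc_le (by linarith) fun x hx => ?_
    have hx1 : ‖x‖ ≤ ‖h‖ := by
      have : Nontrivial A := ⟨⟨h, 0, h0⟩⟩
      exact spectrum.norm_le_norm_of_mem hx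
    have hx2 : x ≤ ‖h‖ := (le_abs_self x).trans hx1
    rw [Real.norm_eq_abs, abs_le]
    rcases le_total x r with h | h
    · rw [max_eq_left (by linarith : 0 ≤ r - x)]; constructor <;> linarith
    · rw [max_eq_right (by linarith : r - x ≤ 0)]; constructor <;> linarith
  rw [← sub_eq_zero, ← norm_le_zero_iff]
  have hc : Tendsto (fun r : ℝ => (‖h‖ - r) * ‖t‖) (𝓝[<] ‖h‖) (𝓝 0) := by
    have : Continuous fun r : ℝ => (‖h‖ - r) * ‖t‖ := by fun_prop
    have h2 := (this.tendsto ‖h‖).mono_left (nhdsWithin_le_nhds (s := Set.Iio ‖h‖))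
    simpa using h2
  refine ge_of_tendsto hc ?_
  filter_upwards [Ioo_mem_nhdsLT hn] with r hr
  exact key r hr.1 hr.2

theorem exists_minimal_proj (h : ∃ t : A, Pos1 t ∧ t ≠ 0 ∧ ¬ Orth 2 t) :
    ∃ e : A, e * e = e ∧ star e = e ∧ e ≠ 0 ∧ ∀ y, ∃ z : ℂ, e * y * e = z • e := by
  let _ := CStarAlgebra.spectralOrder A
  have _ := CStarAlgebra.spectralOrderedRing A
  obtain ⟨t, ht, ht0, hno⟩ := h
  have hnontriv : Nontrivial A := ⟨⟨t, 0, ht0⟩⟩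
  have htn : 0 < ‖t‖ := norm_pos_iff.2 ht0
  have hid : Continuous fun t : ℝ => t := continuous_id
  have ht' : 0 ≤ t := pos1_iff.1 ht
  have htsa : IsSelfAdjoint t := IsSelfAdjoint.of_nonneg ht'
  have htt : t * t = (‖t‖ : ℂ) • t := by
    refine norm_mul_of_not_orth ht hno ht (Commute.refl _) fun r hr0 hr => ?_
    have hq : Continuous fun x : ℝ => max (x - r) 0 := by fun_prop
    have e : cfc (fun x : ℝ => max (x - r) 0) t * t * cfc (fun x : ℝ => max (x - r) 0) t =
        cfc (fun x : ℝ => max (x - r) 0 * x * max (x - r) 0) t := by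
      rw [cfc_mul (fun x : ℝ => max (x - r) 0 * x) _ t (hq.mul hid).continuousOn hq.continuousOn,
        cfc_mul _ (fun t : ℝ => t) t hq.continuousOn hid.continuousOn, cfc_id' ℝ t]
    rw [e]
    intro h0
    have hmem : ‖t‖ ∈ spectrum ℝ t := CStarAlgebra.norm_mem_spectrum_of_nonneg
    have h1 := (norm_apply_le_norm_cfc (fun x : ℝ => max (x - r) 0 * x * max (x - r) 0) t hmem
      ((hq.mul hid).mul hq).continuousOn)
    rw [h0, norm_zero, max_eq_left (by linarith), Real.norm_eq_abs] at h1
    have : 0 < ‖t‖ - r := by linarith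
    have : 0 < (‖t‖ - r) * ‖t‖ * (‖t‖ - r) := by positivity
    rw [abs_of_pos this] at h1
    linarith
  have htn' : (‖t‖ : ℂ) ≠ 0 := by exact_mod_cast htn.ne'
  set e : A := ((‖t‖⁻¹ : ℝ) : ℂ) • t with he
  have hte : t = (‖t‖ : ℂ) • e := by
    rw [he, smul_smul, Complex.ofReal_inv, mul_inv_cancel₀ htn', one_smul]
  have hee : e * e = e := by
    rw [he, smul_mul_smul_comm, htt, smul_smul, Complex.ofReal_inv, mul_assoc,
      inv_mul_cancel₀ htn', mul_one]
  have hes : star e = e := by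
    rw [he, star_smul, htsa.star_eq, Complex.star_def, Complex.conj_ofReal]
  have he0 : e ≠ 0 := by rintro h; apply ht0; rw [hte, h, smul_zero]
  clear_value e
  refine ⟨e, hee, hes, he0, fun y => ?_⟩
  have hy : y ∈ Submodule.span ℂ {a : A | 0 ≤ a} := by
    rw [CStarAlgebra.span_nonneg]; trivial
  induction hy using Submodule.span_induction with
  | zero => exact ⟨0, by simp⟩
  | add x y _ _ hx hy =>
    obtain ⟨a, ha⟩ := hx
    obtain ⟨b, hb⟩ := hy
    exact ⟨a + b, by rw [mul_add, add_mul, ha, hb, add_smul]⟩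
  | smul c x _ hx =>
    obtain ⟨a, ha⟩ := hx
    exact ⟨c * a, by rw [mul_smul_comm, smul_mul_assoc, ha, smul_smul]⟩
  | mem y hy =>
    have hp : Pos1 (e * y * e) := by
      have := (pos1_iff.2 hy).conj e
      rwa [hes] at this
    set h := e * y * e with hh
    have hhe : h * e = h := by rw [hh, mul_assoc, hee]
    have heh : e * h = h := by rw [hh, ← mul_assoc, ← mul_assoc, hee]
    have hh0 : 0 ≤ h := pos1_iff.1 hp
    have hhsa : IsSelfAdjoint h := IsSelfAdjoint.of_nonneg hh0
    have := norm_mul_of_not_orth ht hno hp (by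
      show h * t = t * h
      rw [hte, mul_smul_comm, smul_mul_assoc, hhe, heh]) fun r hr0 hr => ?_
    · refine ⟨‖h‖, ?_⟩
      rw [hte, mul_smul_comm, smul_comm, hhe] at this
      exact smul_right_injective A htn' this
    · have hq : Continuous fun x : ℝ => max (x - r) 0 := by fun_prop
      have hden : ∀ t : ℝ, 0 < max t r := fun t => lt_max_of_lt_right hr0
      have hl : Continuous fun t : ℝ => max (t - r) 0 / max t r :=
        Continuous.div (by fun_prop) (by fun_prop) fun t => (hden t).ne'
      have e1 : cfc (fun x : ℝ => max (x - r) 0) h = cfc (fun x : ℝ => max (x - r) 0 / max x r) h * h := by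
        conv_rhs => rw [← cfc_id' ℝ h, cfc_id' ℝ h]
        have := cfc_mul (fun x : ℝ => max (x - r) 0 / max x r) (fun t : ℝ => t) h hl.continuousOn hid.continuousOn
        rw [cfc_id' ℝ h] at this
        rw [← this]
        congr 1
        ext x
        rcases le_total x r with h | h
        · rw [max_eq_right (by linarith : x - r ≤ 0)]; simp
        · rw [max_eq_left h]
          have : x ≠ 0 := by linarith
          field_simp
      have e2 : cfc (fun x : ℝ => max (x - r) 0) h * e = cfc (fun x : ℝ => max (x - r) 0) h := by
        rw [e1, mul_assoc, hhe]
      rw [hte, mul_smul_comm, e2, smul_mul_assoc,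
        ← cfc_mul _ _ h hq.continuousOn hq.continuousOn]
      intro h0
      have h0' := (smul_eq_zero.1 h0).resolve_left htn'
      have hmem : ‖h‖ ∈ spectrum ℝ h := CStarAlgebra.norm_mem_spectrum_of_nonneg
      have h1 := (norm_apply_le_norm_cfc (fun x : ℝ => max (x - r) 0 * max (x - r) 0) h hmem
        (hq.mul hq).continuousOn)
      rw [h0', norm_zero, max_eq_left (by linarith), Real.norm_eq_abs] at h1
      have : 0 < ‖h‖ - r := by linarith
      have : 0 < (‖h‖ - r) * (‖h‖ - r) := by positivity
      rw [abs_of_pos this] at h1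
      linarith

theorem full_of_simple (hs : IsSimpleCStarAlgebra A) {e : A} (he0 : e ≠ 0) :
    ∃ (n : ℕ) (x y : Fin n → A), ∑ k, x k * e * y k = 1 := by
  let S : AddSubgroup A := AddSubgroup.closure {g | ∃ x y, g = x * e * y}
  have hl : ∀ z g, g ∈ S → z * g ∈ S := by
    intro z g hg
    induction hg using AddSubgroup.closure_induction with
    | mem g hg =>
      obtain ⟨x, y, rfl⟩ := hg
      exact AddSubgroup.subset_closure ⟨z * x, y, by simp [mul_assoc]⟩
    | zero => simp
    | add a b _ _ ha hb => rw [mul_add]; exact S.add_mem ha hb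
    | neg a _ ha => rw [mul_neg]; exact S.neg_mem ha
  have hr : ∀ z g, g ∈ S → g * z ∈ S := by
    intro z g hg
    induction hg using AddSubgroup.closure_induction with
    | mem g hg =>
      obtain ⟨x, y, rfl⟩ := hg
      exact AddSubgroup.subset_closure ⟨x, y * z, by simp [mul_assoc]⟩
    | zero => simp
    | add a b _ _ ha hb => rw [add_mul]; exact S.add_mem ha hb
    | neg a _ ha => rw [neg_mul]; exact S.neg_mem ha
  let T := S.topologicalClosure
  let I : TwoSidedIdeal A := TwoSidedIdeal.mk' (T : Set A) T.zero_mem (fun h1 h2 => T.add_mem h1 h2)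
    (fun h => T.neg_mem h)
    (by
      intro z g hg
      exact map_mem_closure (f := fun g => z * g) (by fun_prop) hg fun g hg => hl z g hg)
    (by
      intro g z hg
      exact map_mem_closure (f := fun g => g * z) (by fun_prop) hg fun g hg => hr z g hg)
  have hI : ∀ t, t ∈ I ↔ t ∈ T := fun t => TwoSidedIdeal.mem_mk' _ _ _ _ _ _ _
  have hcl : IsClosed (I : Set A) := by
    have : (I : Set A) = T := by ext t; exact hI t
    rw [this]
    exact S.isClosed_topologicalClosure
  have h1 : (1 : A) ∈ T := by
    rcases hs I hcl with h | h
    · exfalso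
      have : e ∈ I := (hI e).2 (subset_closure (AddSubgroup.subset_closure ⟨1, 1, by simp⟩))
      rw [h] at this
      exact he0 (by simpa using this)
    · rw [← hI, h]; trivial
  obtain ⟨g, hg, hd⟩ := Metric.mem_closure_iff.1 h1 1 one_pos
  rw [dist_eq_norm] at hd
  have hu : IsUnit g := by
    have := isUnit_one_sub_of_norm_lt_one hd
    rwa [sub_sub_cancel] at this
  obtain ⟨u, rfl⟩ := hu
  have h1S : (1 : A) ∈ S := by
    have := hl (↑u⁻¹) _ hg
    rwa [Units.inv_mul] at this
  have gen : ∀ g ∈ S, ∃ (n : ℕ) (x y : Fin n → A), ∑ k, x k * e * y k = g := by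
    intro g hg
    induction hg using AddSubgroup.closure_induction with
    | mem g hg =>
      obtain ⟨x, y, rfl⟩ := hg
      exact ⟨1, fun _ => x, fun _ => y, by simp⟩
    | zero => exact ⟨0, fun _ => 0, fun _ => 0, by simp⟩
    | add a b _ _ ha hb =>
      obtain ⟨n, x, y, rfl⟩ := ha
      obtain ⟨m, x', y', rfl⟩ := hb
      refine ⟨n + m, Fin.append x x', Fin.append y y', ?_⟩
      rw [Fin.sum_univ_add]
      simp
    | neg a _ ha =>
      obtain ⟨n, x, y, rfl⟩ := ha
      exact ⟨n, fun k => - x k, y, by simp⟩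
  exact gen 1 h1S

end Elementary


section Elementary

variable {A : Type} [CStarAlgebra A]
variable {ι κ μ : Type} [Fintype ι] [Fintype κ] [Fintype μ]

theorem cls_diagonal_fin (n : ℕ) (d : Fin n → A) :
    cls (Matrix.diagonal d) = ∑ i, cls (sg (d i)) := by
  rw [← cls_blockDiagonal]
  have : Matrix.diagonal d = (Matrix.blockDiagonal fun i => sg (d i)).submatrix
      (Equiv.punitProd (Fin n)).symm (Equiv.punitProd (Fin n)).symm := by
    ext i j
    rcases eq_or_ne i j with rfl | h
    · simp [sg, Matrix.blockDiagonal_apply]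
    · simp [Matrix.blockDiagonal_apply, h]
  rw [this, cls_submatrix]

theorem cls_diagonal_fintype [DecidableEq ι] (d : ι → A) :
    cls (Matrix.diagonal d) = ∑ i, cls (sg (d i)) := by
  have e := (Fintype.equivFin ι).symm
  rw [← cls_submatrix _ e, Matrix.submatrix_diagonal_equiv, cls_diagonal_fin]
  exact Equiv.sum_comp e fun i => cls (sg (d i))

theorem map_smul_conj (e : A) (X Y Z : Matrix ι ι ℂ) :
    (X * Y * Z).map (fun z => z • e) =
      X.map (algebraMap ℂ A) * Y.map (fun z => z • e) * Z.map (algebraMap ℂ A) := by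
  ext i j
  simp [Matrix.mul_apply, Finset.sum_smul, Finset.sum_mul, Algebra.algebraMap_eq_smul_one,
    smul_smul, mul_comm, Finset.smul_sum, Finset.mul_sum]

theorem cls_corner {e : A} (hee : e * e = e) (hes : star e = e) (he0 : e ≠ 0)
    {M : Matrix ι ι A} (hM : MatPos M) (h : ∀ i j, ∃ z : ℂ, M i j = z • e) :
    ∃ r : ℕ, cls M = r • cls (sg e) := by
  classical
  choose T hT using h
  have hTh : (Matrix.of T).IsHermitian := by
    ext i j
    have h1 := congrFun (congrFun hM.conjTranspose_eq i) j
    rw [Matrix.conjTranspose_apply, hT, hT, star_smul, hes] at h1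
    exact smul_left_injective ℂ he0 h1
  have hMT : M = (Matrix.of T).map (fun z => z • e) := by ext i j; exact hT i j
  have hsp := hTh.spectral_theorem
  set U : Matrix ι ι ℂ := (hTh.eigenvectorUnitary : Matrix ι ι ℂ) with hU
  have hUU : star U * U = 1 := Unitary.coe_star_mul_self _
  rw [Unitary.conjStarAlgAut_apply] at hsp
  set D : Matrix ι ι ℂ := Matrix.diagonal (RCLike.ofReal ∘ hTh.eigenvalues) with hD
  change Matrix.of T = U * D * star U at hsp
  have hsp' : D = star U * Matrix.of T * U := by
    rw [hsp]
    calc D = (star U * U) * D * (star U * U) := by rw [hUU]; simp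
      _ = _ := by simp only [Matrix.mul_assoc]
  set V := U.map (algebraMap ℂ A) with hV
  have hVs : (star U).map (algebraMap ℂ A) = Vᴴ := by
    ext i j
    simp [hV, Matrix.star_apply, Algebra.algebraMap_eq_smul_one]
  have hDg : D.map (fun z => z • e) =
      Matrix.diagonal fun i => ((hTh.eigenvalues i : ℝ) : ℂ) • e := by
    rw [hD, Matrix.diagonal_map (by simp)]
    rfl
  have e1 : M = V * D.map (fun z => z • e) * Vᴴ := by
    rw [hMT, hsp, map_smul_conj, hVs]
  have e2 : D.map (fun z => z • e) = Vᴴ * M * Vᴴᴴ := by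
    rw [hsp', map_smul_conj, hVs, ← hMT, Matrix.conjTranspose_conjTranspose]
  have hDpos : MatPos (D.map (fun z => z • e)) := by
    rw [e2]; exact hM.conj _
  have hcl : cls M = cls (D.map (fun z => z • e)) := by
    apply le_antisymm
    · rw [e1]; exact cls_conj_le _ _
    · rw [e2]; exact cls_conj_le _ _
  rw [hDg] at hcl hDpos
  rw [hcl, cls_diagonal_fintype]
  have hnn : ∀ i, 0 ≤ hTh.eigenvalues i := by
    let _ := CStarAlgebra.spectralOrder A
    have _ := CStarAlgebra.spectralOrderedRing A
    intro i
    by_contra! hneg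
    obtain ⟨c, hc⟩ := hDpos
    have h1 : 0 ≤ ((hTh.eigenvalues i : ℝ) : ℂ) • e := by
      have := congrFun (congrFun hc i) i
      rw [Matrix.diagonal_apply_eq] at this
      rw [this]
      simp only [Matrix.mul_apply, Matrix.conjTranspose_apply]
      exact Finset.sum_nonneg fun k _ => star_mul_self_nonneg _
    have h2 : 0 ≤ -(((hTh.eigenvalues i : ℝ) : ℂ) • e) := by
      rw [gen_nonneg_iff]
      refine ⟨((√(-hTh.eigenvalues i) : ℝ) : ℂ) • e, ?_⟩
      rw [star_smul, hes, Complex.star_def, Complex.conj_ofReal, smul_mul_smul_comm, hee,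
        ← Complex.ofReal_mul, Real.mul_self_sqrt (by linarith)]
      simp
    have h3 := le_antisymm (neg_nonneg.1 h2) h1
    rcases smul_eq_zero.1 h3 with h | h
    · have : hTh.eigenvalues i = 0 := by exact_mod_cast h
      linarith
    · exact he0 h
  have hr : ∀ i, ∃ r : ℕ, cls (sg (((hTh.eigenvalues i : ℝ) : ℂ) • e)) = r • cls (sg e) := by
    intro i
    have hsm : ∀ (c : ℂ) (x : A), sg (c • x) = c • sg x := by intro c x; ext; simp [sg]
    rcases (hnn i).eq_or_lt with h | h
    · refine ⟨0, ?_⟩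
      rw [← h, Complex.ofReal_zero, zero_smul, zero_nsmul]
      have : sg (0 : A) = 0 := by ext; simp [sg]
      rw [this, cls_zero]
    · refine ⟨1, ?_⟩
      rw [one_nsmul, hsm]
      apply le_antisymm (cls_smul_le _ h.le _)
      have h2 := cls_smul_le (hTh.eigenvalues i)⁻¹ (inv_nonneg.2 h.le)
        (((hTh.eigenvalues i : ℝ) : ℂ) • sg e)
      rwa [smul_smul, ← Complex.ofReal_mul, inv_mul_cancel₀ h.ne', Complex.ofReal_one,
        one_smul] at h2
  choose r hr using hr
  refine ⟨∑ i, r i, ?_⟩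
  rw [Finset.sum_congr rfl fun i _ => hr i, ← Finset.sum_nsmul_assoc]

theorem cls_eq_nsmul (hs : IsSimpleCStarAlgebra A) {e : A} (hee : e * e = e) (hes : star e = e)
    (he0 : e ≠ 0) (hz : ∀ y, ∃ z : ℂ, e * y * e = z • e) {n : ℕ} {a : Matrix (Fin n) (Fin n) A}
    (ha : MatPos a) : ∃ r : ℕ, cls a = r • cls (sg e) := by
  classical
  obtain ⟨m, x, y, hxy⟩ := full_of_simple hs he0
  obtain ⟨c, rfl⟩ := ha
  let X : Matrix (Fin n) (Fin n × Fin m) A := Matrix.of fun i p => if i = p.1 then x p.2 * e else 0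
  let Y : Matrix (Fin n × Fin m) (Fin n) A := Matrix.of fun p i => if i = p.1 then e * y p.2 else 0
  have hXY : X * Y = 1 := by
    ext i j
    simp only [X, Y, Matrix.mul_apply, Matrix.of_apply, Fintype.sum_prod_type]
    rw [Finset.sum_eq_single i]
    · rcases eq_or_ne i j with rfl | hij
      · simp only [if_true, Matrix.one_apply_eq, ← hxy]
        refine Finset.sum_congr rfl fun k _ => ?_
        rw [← mul_assoc, mul_assoc (x k), hee]
      · simp [hij, hij.symm]
    · intro b _ hb; simp [hb.symm]
    · simp
  set U := Y * c with hU
  have hc : c = X * U := by rw [hU, ← Matrix.mul_assoc, hXY, Matrix.one_mul]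
  have hUe : ∀ p i, e * U p i = U p i := by
    intro p i
    simp only [hU, Matrix.mul_apply, Finset.mul_sum]
    refine Finset.sum_congr rfl fun j _ => ?_
    simp only [Y, Matrix.of_apply]
    split_ifs
    · rw [← mul_assoc, ← mul_assoc, hee]
    · simp
  have hcl : cls (cᴴ * c) = cls (U * Uᴴ) := by
    have h1 : cls (cᴴ * c) = cls (c * cᴴ) := by
      apply le_antisymm
      · simpa using cls_mul_star_le cᴴ
      · exact cls_mul_star_le c
    rw [h1]
    apply le_antisymm
    · have : c * cᴴ = X * (U * Uᴴ) * Xᴴ := by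
        conv_lhs => rw [hc]
        simp only [Matrix.conjTranspose_mul, Matrix.mul_assoc]
      rw [this]; exact cls_conj_le _ _
    · have : U * Uᴴ = Y * (c * cᴴ) * Yᴴ := by
        rw [hU]; simp only [Matrix.conjTranspose_mul, Matrix.mul_assoc]
      rw [this]; exact cls_conj_le _ _
  rw [hcl]
  refine cls_corner hee hes he0 (by simpa using matPos_rect Uᴴ) fun p q => ?_
  obtain ⟨z, hz⟩ := hz ((U * Uᴴ) p q)
  refine ⟨z, ?_⟩
  rw [← hz]
  simp only [Matrix.mul_apply, Matrix.conjTranspose_apply, Finset.mul_sum, Finset.sum_mul]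
  refine Finset.sum_congr rfl fun i _ => ?_
  have h2 : star (U q i) * e = star (U q i) := by
    conv_rhs => rw [← hUe q i, star_mul, hes]
  rw [← mul_assoc, hUe, mul_assoc, h2]

theorem le_of_nsmul_le {e : A} (hee : e * e = e) (hes : star e = e)
    (he0 : e ≠ 0) (hz : ∀ y, ∃ z : ℂ, e * y * e = z • e) {p q : ℕ}
    (h : p • cls (sg e) ≤ q • cls (sg e)) : p ≤ q := by
  classical
  rw [← cls_diagonal, ← cls_diagonal, cls_le_cls] at h
  obtain ⟨v, hv⟩ := h
  choose z hz using hz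
  let w : ℕ → Matrix (Fin p) (Fin q) ℂ := fun k => (v k).map z
  have hw : Tendsto (fun k => w k * (w k)ᴴ) atTop (𝓝 1) := by
    refine tendsto_pi_nhds.2 fun i => tendsto_pi_nhds.2 fun l => ?_
    rw [(isClosedEmbedding_smul_left (𝕜 := ℂ) he0).isInducing.tendsto_nhds_iff]
    have h1 : Tendsto (fun k => e * ((v k * (diagonal (fun _ => e) : Matrix (Fin q) (Fin q) A) * (v k)ᴴ : Matrix (Fin p) (Fin p) A) i l) * e) atTop
        (𝓝 (e * ((diagonal (fun _ => e) : Matrix (Fin p) (Fin p) A) i l) * e)) := by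
      have := tendsto_pi_nhds.1 (tendsto_pi_nhds.1 hv i) l
      exact (this.const_mul e).mul_const e
    have e1 : e * ((diagonal (fun _ => e) : Matrix (Fin p) (Fin p) A) i l) * e =
        ((1 : Matrix (Fin p) (Fin p) ℂ) i l) • e := by
      rcases eq_or_ne i l with rfl | hil
      · simp [hee]
      · simp [hil]
    rw [e1] at h1
    refine h1.congr fun k => ?_
    rw [Matrix.mul_apply]
    simp only [Matrix.mul_diagonal]
    simp only [Function.comp, w, Matrix.mul_apply, Matrix.conjTranspose_apply,
      Matrix.map_apply, Finset.sum_smul, Finset.mul_sum, Finset.sum_mul]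
    refine Finset.sum_congr rfl fun j _ => ?_
    have h2 : e * star (v k l j) * e = star (z (v k l j)) • e := by
      have := congrArg star (hz (v k l j))
      simpa [hes, mul_assoc] using this
    calc e * (v k i j * e * star (v k l j)) * e
        = (e * v k i j * e) * (e * star (v k l j) * e) := by
          rw [show (e * v k i j * e) * (e * star (v k l j) * e) =
            e * v k i j * (e * e) * star (v k l j) * e by simp only [mul_assoc], hee]
          simp only [mul_assoc]
      _ = _ := by rw [hz, h2, smul_mul_smul_comm, hee]
  by_contra! hlt
  have hdet : ∀ k, (w k * (w k)ᴴ).det = 0 := by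
    intro k
    by_contra hne
    have hu : IsUnit (w k * (w k)ᴴ) := (Matrix.isUnit_iff_isUnit_det _).2 (isUnit_iff_ne_zero.2 hne)
    have h1 := Matrix.rank_of_isUnit _ hu
    have h2 := Matrix.rank_mul_le_left (w k) (w k)ᴴ
    have h3 := Matrix.rank_le_width (w k)
    rw [h1, Fintype.card_fin] at h2
    omega
  have hc : Continuous fun M : Matrix (Fin p) (Fin p) ℂ => M.det := continuous_id.matrix_det
  have := (hc.tendsto 1).comp hw
  simp only [Function.comp_def, hdet, Matrix.det_one] at this
  exact one_ne_zero (tendsto_nhds_unique tendsto_const_nhds this).symm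

theorem elementary_case (N : ℕ) (hs : IsSimpleCStarAlgebra A)
    (h : ∃ (n : ℕ) (c : A), Pos1 c ∧ c ≠ 0 ∧ ¬ Orth n c) : NComparison A N := by
  obtain ⟨e, hee, hes, he0, hz⟩ := exists_minimal_proj (exists_not_orth_two h)
  intro na mb a b ha hb hab
  rw [← cls_le_cls, cls_blockDiagonal'_fin]
  obtain ⟨k, hk, hkab⟩ := hab 0
  rw [← cls_le_cls, cls_matRep, cls_matRep] at hkab
  refine le_trans ?_ (Finset.single_le_sum (f := fun j => cls (b j))
    (fun j _ => CW.zero_le _) (Finset.mem_univ 0))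
  obtain ⟨r, hr⟩ := cls_eq_nsmul hs hee hes he0 hz ha
  obtain ⟨s, hs⟩ := cls_eq_nsmul hs hee hes he0 hz (hb 0)
  rw [hr, hs, smul_smul, smul_smul] at hkab
  have h1 := le_of_nsmul_le hee hes he0 hz hkab
  have h2 : r ≤ s := by
    by_contra! hlt
    nlinarith
  show cls a ≤ cls (b 0)
  rw [hr, hs]
  exact nsmul_le_nsmul_left (CW.zero_le _) h2

end Elementary

/-- If `P` is a class of stably finite unital C*-algebras each having `n`-comparison
(in the sense of Winter) for an integer `n ≥ 0`, then every simple unital C*-algebra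
that is asymptotically tracially in `P` has `n`-comparison. -/
theorem nComparison_of_asympTraciallyIn
    (P : BundledCStarAlgebra → Prop) (n : ℕ)
    (hP : ∀ B : BundledCStarAlgebra, P B → StablyFinite B.carrier ∧ NComparison B.carrier n)
    (A : Type) [CStarAlgebra A]
    (hsimple : IsSimpleCStarAlgebra A)
    (hA : AsympTraciallyIn P A) :
    NComparison A n := by
  by_cases ho : ∀ (n : ℕ) (c : A), Pos1 c → c ≠ 0 → Orth n c
  · exact nonelementary_case P n (fun B hB => (hP B hB).2) hsimple hA ho
  · push Not at ho
    exact elementary_case n hsimple ho
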